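/- arXiv:2012.12357 — 3 statements merged into one kernel-verified Lean document; each statement's English description precedes it below -/
import Mathlib

section
/- Let n be a positive integer, let u be a classical solution of (CH_n) on [0,T), and let 0 < T₀ < T and θ ∈ (0,1). Suppose that e^{θx}|u(0,x)| and e^{θx}|u_x(0,x)| remain bounded as x → ∞. Then there exists a constant L ≥ 0 such that e^{θx}(|u(t,x)| + |u_x(t,x)|) ≤ L for all t ∈ [0,T₀] and all x ≥ 0; in particular |u(t,x)| = O(e^{−θx}) and |u_x(t,x)| = O(e^{−θx}) as x → ∞, uniformly in t ∈ [0,T₀]. -/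
open Real MeasureTheory Filter Topology
open scoped ENNReal

/-- The Green function `g(x) = e^{-|x|}/2` of `1 - ∂ₓ²` on `ℝ`. -/
noncomputable def g (x : ℝ) : ℝ := Real.exp (-|x|) / 2

/-- `u_x`. -/
noncomputable def ux (u : ℝ → ℝ → ℝ) (t x : ℝ) : ℝ := deriv (u t) x
/-- `u_{xx}`. -/
noncomputable def uxx (u : ℝ → ℝ → ℝ) (t x : ℝ) : ℝ := deriv (deriv (u t)) x
/-- `u_{xxx}`. -/
noncomputable def uxxx (u : ℝ → ℝ → ℝ) (t x : ℝ) : ℝ := deriv (deriv (deriv (u t))) x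
/-- `u_t`. -/
noncomputable def ut (u : ℝ → ℝ → ℝ) (t x : ℝ) : ℝ := deriv (fun s => u s x) t
/-- `u_{tx}`. -/
noncomputable def utx (u : ℝ → ℝ → ℝ) (t x : ℝ) : ℝ := deriv (fun s => ux u s x) t
/-- `u_{txx}`. -/
noncomputable def utxx (u : ℝ → ℝ → ℝ) (t x : ℝ) : ℝ := deriv (fun s => uxx u s x) t

/-- `f_t(x) = (n/2) u^{n-1} u_x² + (n(n+3)/(2(n+1))) u^{n+1}`. -/
noncomputable def fLoc (n : ℕ) (u : ℝ → ℝ → ℝ) (t x : ℝ) : ℝ :=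
  ((n : ℝ) / 2) * u t x ^ (n - 1) * ux u t x ^ 2
    + ((n : ℝ) * ((n : ℝ) + 3) / (2 * ((n : ℝ) + 1))) * u t x ^ (n + 1)

/-- `F_t(x) = ∂ₓ (g ∗ f_t)(x)`. -/
noncomputable def FLoc (n : ℕ) (u : ℝ → ℝ → ℝ) (t x : ℝ) : ℝ :=
  deriv (fun z => ∫ y : ℝ, g (z - y) * fLoc n u t y) x

/-- The equation (CH_n) holds pointwise at `(t,x)`. -/
def CHn (n : ℕ) (u : ℝ → ℝ → ℝ) (t x : ℝ) : Prop :=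
  ut u t x - utxx u t x
      + (((n : ℝ) + 1) * ((n : ℝ) + 2) / 2) * u t x ^ n * ux u t x
    = ((n : ℝ) * ((n : ℝ) - 1) / 2) * u t x ^ (n - 2) * ux u t x ^ 3
      + 2 * (n : ℝ) * u t x ^ (n - 1) * ux u t x * uxx u t x
      + u t x ^ n * uxxx u t x

/-- The time interval `[0, T)`, where `T ∈ (0, ∞]`. -/
def timeDomain (T : ℝ≥0∞) : Set ℝ := {t : ℝ | 0 ≤ t ∧ ENNReal.ofReal t < T}

/-- A function which is bounded, integrable, square-integrable and tends to `0` at `±∞`. -/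
def Decays (w : ℝ → ℝ) : Prop :=
  (∃ C : ℝ, ∀ x : ℝ, |w x| ≤ C) ∧ Integrable w ∧
    Integrable (fun x => w x ^ 2) ∧ Tendsto w (cocompact ℝ) (𝓝 0)

/-- A classical solution of (CH_n) on `[0,T) × ℝ`. -/
structure IsClassicalSolution (n : ℕ) (T : ℝ≥0∞) (u : ℝ → ℝ → ℝ) : Prop where
  contDiff_x : ∀ t ∈ timeDomain T, ContDiff ℝ 3 (u t)
  diff_t : ∀ x : ℝ, ∀ t ∈ timeDomain T, DifferentiableAt ℝ (fun s => u s x) t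
  diff_tx : ∀ x : ℝ, ∀ t ∈ timeDomain T, DifferentiableAt ℝ (fun s => ux u s x) t
  diff_txx : ∀ x : ℝ, ∀ t ∈ timeDomain T, DifferentiableAt ℝ (fun s => uxx u s x) t
  cont_ut : ContinuousOn (fun p : ℝ × ℝ => ut u p.1 p.2) (timeDomain T ×ˢ Set.univ)
  cont_utx : ContinuousOn (fun p : ℝ × ℝ => utx u p.1 p.2) (timeDomain T ×ˢ Set.univ)
  cont_utxx : ContinuousOn (fun p : ℝ × ℝ => utxx u p.1 p.2) (timeDomain T ×ˢ Set.univ)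
  pde : ∀ t ∈ timeDomain T, ∀ x : ℝ, CHn n u t x
  nonlocal : ∀ t ∈ timeDomain T, ∀ x : ℝ,
    ut u t x + u t x ^ n * ux u t x + FLoc n u t x = 0
  decay_u : ∀ t ∈ timeDomain T, Decays (u t)
  decay_ux : ∀ t ∈ timeDomain T, Decays (ux u t)
  decay_uxx : ∀ t ∈ timeDomain T, Decays (uxx u t)
  decay_ut : ∀ t ∈ timeDomain T, Decays (ut u t)
  sup_bound : ∀ T₀ ∈ timeDomain T, ∃ M : ℝ, ∀ t ∈ Set.Icc (0 : ℝ) T₀, ∀ x : ℝ,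
    |u t x| + |ux u t x| ≤ M


lemma half_conv (f : ℝ → ℝ) (hf : Continuous f) (θ a b : ℝ) (h0 : 0 < θ) (h1 : θ < 1)
    (ha : 0 ≤ a) (hb : 0 ≤ b)
    (hbd : ∀ y, |f y| ≤ a * exp (-(θ * y)) + b * exp (θ * y)) :
    (∀ z, IntegrableOn (fun y => exp y * f y) (Set.Iic z)) ∧
    (∀ z, HasDerivAt (fun z => ∫ y in Set.Iic z, exp y * f y) (exp z * f z) z) ∧
    (∀ z, |∫ y in Set.Iic z, exp y * f y|
      ≤ exp z * ((a * exp (-(θ * z)) + b * exp (θ * z)) / (1 - θ))) := by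
  have hc : Continuous (fun y => exp y * f y) := by fun_prop
  have i1 : ∀ z, IntegrableOn (fun y => a * exp ((1 - θ) * y)) (Set.Iic z) := fun z =>
    (integrableOn_exp_mul_Iic (by linarith) z).const_mul a
  have i2 : ∀ z, IntegrableOn (fun y => b * exp ((1 + θ) * y)) (Set.Iic z) := fun z =>
    (integrableOn_exp_mul_Iic (by linarith) z).const_mul b
  have hB : ∀ y, ‖exp y * f y‖ ≤ a * exp ((1 - θ) * y) + b * exp ((1 + θ) * y) := by
    intro y
    rw [norm_mul, Real.norm_eq_abs, Real.norm_eq_abs, abs_of_pos (exp_pos y)]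
    have := mul_le_mul_of_nonneg_left (hbd y) (exp_pos y).le
    have e1 : exp ((1 - θ) * y) = exp y * exp (-(θ * y)) := by rw [← exp_add]; ring_nf
    have e2 : exp ((1 + θ) * y) = exp y * exp (θ * y) := by rw [← exp_add]; ring_nf
    rw [e1, e2]; linarith
  have hI : ∀ z, IntegrableOn (fun y => exp y * f y) (Set.Iic z) := by
    intro z
    refine Integrable.mono' ((i1 z).add (i2 z)) hc.aestronglyMeasurable ?_
    exact Eventually.of_forall hB
  refine ⟨hI, ?_, ?_⟩
  · intro z
    have h : (fun z => ∫ y in Set.Iic z, exp y * f y)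
        = fun z => (∫ y in Set.Iic 0, exp y * f y) + ∫ y in (0:ℝ)..z, exp y * f y := by
      funext z
      rw [← intervalIntegral.integral_Iic_sub_Iic (hI 0) (hI z)]; ring
    rw [h]
    exact (intervalIntegral.integral_hasDerivAt_right (hc.intervalIntegrable _ _)
      (hc.stronglyMeasurableAtFilter _ _) hc.continuousAt).const_add _
  · intro z
    have h := norm_integral_le_of_norm_le ((i1 z).add (i2 z)) (Eventually.of_forall hB)
    rw [Real.norm_eq_abs] at h
    refine h.trans ?_
    have : ∫ y in Set.Iic z, (a * exp ((1 - θ) * y) + b * exp ((1 + θ) * y))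
        = a * (exp ((1 - θ) * z) / (1 - θ)) + b * (exp ((1 + θ) * z) / (1 + θ)) := by
      rw [integral_add (i1 z) (i2 z), integral_const_mul, integral_const_mul,
        integral_exp_mul_Iic (by linarith), integral_exp_mul_Iic (by linarith)]
    simp only [Pi.add_apply] at *
    rw [this]
    have e1 : exp ((1 - θ) * z) = exp z * exp (-(θ * z)) := by rw [← exp_add]; ring_nf
    have e2 : exp ((1 + θ) * z) = exp z * exp (θ * z) := by rw [← exp_add]; ring_nf
    have : exp ((1 + θ) * z) / (1 + θ) ≤ exp ((1 + θ) * z) / (1 - θ) :=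
      div_le_div_of_nonneg_left (exp_pos _).le (by linarith) (by linarith)
    have := mul_le_mul_of_nonneg_left this hb
    rw [e1] ; rw [e2] at *
    calc _ ≤ _ := add_le_add_right this _
      _ = _ := by ring

lemma conv_facts (f : ℝ → ℝ) (hf : Continuous f) (θ a b : ℝ) (h0 : 0 < θ) (h1 : θ < 1)
    (ha : 0 ≤ a) (hb : 0 ≤ b)
    (hbd : ∀ y, |f y| ≤ a * exp (-(θ * y)) + b * exp (θ * y)) :
    ∃ G G' : ℝ → ℝ, (fun z => ∫ y : ℝ, g (z - y) * f y) = G ∧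
      ∀ z, HasDerivAt G (G' z) z ∧ HasDerivAt G' (G z - f z) z ∧
        |G z| ≤ (a * exp (-(θ * z)) + b * exp (θ * z)) / (1 - θ) ∧
        |G' z| ≤ (a * exp (-(θ * z)) + b * exp (θ * z)) / (1 - θ) := by
  obtain ⟨iP, dP, bP⟩ := half_conv f hf θ a b h0 h1 ha hb hbd
  obtain ⟨iQ, dQ, bQ⟩ := half_conv (fun y => f (-y)) (by fun_prop) θ b a h0 h1 hb ha (by
    intro y; have := hbd (-y); simp only [mul_neg, neg_neg] at this; linarith)
  set P := fun z => ∫ y in Set.Iic z, exp y * f y with hP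
  set Q := fun z => ∫ y in Set.Iic z, exp y * f (-y) with hQ
  have hQ' : ∀ z, ∫ y in Set.Ioi z, exp (-y) * f y = Q (-z) := by
    intro z
    have := integral_comp_neg_Iic (-z) (fun y => exp (-y) * f y)
    simp only [neg_neg] at this
    rw [← this]
  have iQ' : ∀ z, IntegrableOn (fun y => exp (-y) * f y) (Set.Ioi z) := by
    intro z
    have := (iQ (-z)).comp_neg
    simp only [neg_neg, Set.neg_Iic] at this
    exact this.mono_set Set.Ioi_subset_Ici_self
  have dQ' : ∀ z, HasDerivAt (fun z => Q (-z)) (-(exp (-z) * f z)) z := by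
    intro z
    have := (dQ (-z)).comp z (hasDerivAt_neg z)
    simpa using! this
  have bP' : ∀ z, |exp (-z) * P z| ≤ (a * exp (-(θ * z)) + b * exp (θ * z)) / (1 - θ) := by
    intro z
    rw [abs_mul, abs_of_pos (exp_pos _)]
    calc _ ≤ exp (-z) * _ := mul_le_mul_of_nonneg_left (bP z) (exp_pos _).le
      _ = _ := by rw [← mul_assoc, ← exp_add]; simp
  have bQ' : ∀ z, |exp z * Q (-z)| ≤ (a * exp (-(θ * z)) + b * exp (θ * z)) / (1 - θ) := by
    intro z
    rw [abs_mul, abs_of_pos (exp_pos _)]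
    calc _ ≤ exp z * _ := mul_le_mul_of_nonneg_left (bQ (-z)) (exp_pos _).le
      _ = _ := by rw [← mul_assoc, ← exp_add]; simp [add_comm]
  have dE : ∀ z : ℝ, HasDerivAt (fun z => exp (-z)) (-exp (-z)) z := by
    intro z; simpa using! (hasDerivAt_neg z).exp
  refine ⟨fun z => (exp (-z) * P z + exp z * Q (-z)) / 2,
    fun z => (-(exp (-z) * P z) + exp z * Q (-z)) / 2, ?_, ?_⟩
  · funext z
    have j1 : IntegrableOn (fun y => g (z - y) * f y) (Set.Iic z) := by
      refine IntegrableOn.congr_fun ((iP z).const_mul (exp (-z) / 2)) ?_ measurableSet_Iic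
      intro y hy
      simp only [g, abs_of_nonneg (sub_nonneg.2 (Set.mem_Iic.1 hy)), neg_sub, exp_sub, exp_neg]
      ring
    have j2 : IntegrableOn (fun y => g (z - y) * f y) (Set.Ioi z) := by
      refine IntegrableOn.congr_fun ((iQ' z).const_mul (exp z / 2)) ?_ measurableSet_Ioi
      intro y hy
      simp only [g, abs_of_neg (sub_neg.2 (Set.mem_Ioi.1 hy)), neg_neg, exp_sub, exp_neg]
      ring
    rw [← intervalIntegral.integral_Iic_add_Ioi j1 j2]
    have k1 : ∫ y in Set.Iic z, g (z - y) * f y = exp (-z) / 2 * P z := by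
      rw [hP]; simp only; rw [← integral_const_mul]
      refine setIntegral_congr_fun measurableSet_Iic ?_
      intro y hy
      simp only [g, abs_of_nonneg (sub_nonneg.2 (Set.mem_Iic.1 hy)), neg_sub, exp_sub, exp_neg]
      ring
    have k2 : ∫ y in Set.Ioi z, g (z - y) * f y = exp z / 2 * Q (-z) := by
      rw [← hQ', ← integral_const_mul]
      refine setIntegral_congr_fun measurableSet_Ioi ?_
      intro y hy
      simp only [g, abs_of_neg (sub_neg.2 (Set.mem_Ioi.1 hy)), neg_neg, exp_sub, exp_neg]
      ring
    rw [k1, k2]; ring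
  · intro z
    have E : exp (-z) * exp z = 1 := by rw [← exp_add]; simp
    refine ⟨?_, ?_, ?_, ?_⟩
    · refine ((((dE z).mul (dP z)).add ((hasDerivAt_exp z).mul (dQ' z))).div_const 2).congr_deriv ?_
      simp only [hP]; ring
    · refine ((((dE z).mul (dP z)).neg.add ((hasDerivAt_exp z).mul (dQ' z))).div_const 2).congr_deriv ?_
      simp only [hP]
      linear_combination (-f z) * E
    · rw [abs_div, abs_two]
      have := abs_add_le (exp (-z) * P z) (exp z * Q (-z))
      have := bP' z; have := bQ' z
      linarith
    · rw [abs_div, abs_two]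
      have := abs_add_le (-(exp (-z) * P z)) (exp z * Q (-z))
      rw [abs_neg] at this
      have := bP' z; have := bQ' z
      linarith

lemma joint_cont (v w : ℝ → ℝ → ℝ) (T₀ X : ℝ)
    (hv : ∀ t ∈ Set.Icc (0 : ℝ) T₀, Continuous (v t))
    (hd : ∀ x : ℝ, ∀ t ∈ Set.Icc (0 : ℝ) T₀, HasDerivAt (fun s => v s x) (w t x) t)
    (hw : ContinuousOn (fun p : ℝ × ℝ => w p.1 p.2) (Set.Icc (0 : ℝ) T₀ ×ˢ Set.univ)) :
    ContinuousOn (fun p : ℝ × ℝ => v p.1 p.2) (Set.Icc (0 : ℝ) T₀ ×ˢ Set.Icc (-X) X) := by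
  have hc : IsCompact (Set.Icc (0 : ℝ) T₀ ×ˢ Set.Icc (-X) X) := isCompact_Icc.prod isCompact_Icc
  obtain ⟨C, hC⟩ := hc.exists_bound_of_continuousOn
    (hw.mono (Set.prod_mono subset_rfl (Set.subset_univ _)))
  refine continuousOn_prod_of_continuousOn_lipschitzOnWith _ C.toNNReal
    (fun a ha => (hv a ha).continuousOn) ?_
  intro b hb
  refine (convex_Icc (0:ℝ) T₀).lipschitzOnWith_of_nnnorm_hasDerivWithin_le
    (f' := fun t => w t b) (fun t ht => (hd b t ht).hasDerivWithinAt) ?_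
  intro t ht
  have := hC (t, b) ⟨ht, hb⟩
  rw [← NNReal.coe_le_coe, coe_nnnorm]
  exact this.trans (Real.le_coe_toNNReal C)

lemma swap_deriv (v v' vt w : ℝ → ℝ → ℝ) (t ε : ℝ) (hε : 0 < ε)
    (hv : ∀ s ∈ Metric.closedBall t ε, ∀ x, HasDerivAt (v s) (v' s x) x)
    (hv' : ∀ s ∈ Metric.closedBall t ε, Continuous (v' s))
    (hvt : ∀ x, HasDerivAt (fun s => v s x) (vt t x) t)
    (hd : ∀ s ∈ Metric.closedBall t ε, ∀ x, HasDerivAt (fun s => v' s x) (w s x) s)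
    (hw : ContinuousOn (fun p : ℝ × ℝ => w p.1 p.2) (Metric.closedBall t ε ×ˢ Set.univ)) (x : ℝ) :
    HasDerivAt (vt t) (w t x) x := by
  have ht : t ∈ Metric.closedBall t ε := Metric.mem_closedBall_self hε.le
  have hwt : Continuous (w t) := by
    rw [← continuousOn_univ]
    exact hw.comp (f := fun y => (t, y)) (by fun_prop) (fun y _ => ⟨ht, trivial⟩)
  have key : ∀ z, vt t z = vt t 0 + ∫ y in (0:ℝ)..z, w t y := by
    intro z
    have hc : IsCompact (Metric.closedBall t ε ×ˢ Set.uIcc 0 z) :=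
      (isCompact_closedBall t ε).prod isCompact_uIcc
    obtain ⟨C, hC⟩ := hc.exists_bound_of_continuousOn
      (hw.mono (Set.prod_mono subset_rfl (Set.subset_univ _)))
    have h1 := (intervalIntegral.hasDerivAt_integral_of_dominated_loc_of_deriv_le
      (μ := volume) (F := v') (F' := w) (x₀ := t) (a := 0) (b := z) (bound := fun _ => C)
      (s := Metric.closedBall t ε)
      (Metric.closedBall_mem_nhds t hε)
      (by
        filter_upwards [Metric.closedBall_mem_nhds t hε] with s hs
        exact (hv' s hs).aestronglyMeasurable)
      ((hv' t ht).intervalIntegrable _ _)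
      hwt.aestronglyMeasurable
      (Eventually.of_forall fun y hy s hs => hC (s, y) ⟨hs, Set.uIoc_subset_uIcc hy⟩)
      intervalIntegrable_const
      (Eventually.of_forall fun y _ s hs => hd s hs y)).2
    have h2 : HasDerivAt (fun s => v s z - v s 0) (vt t z - vt t 0) t := (hvt z).sub (hvt 0)
    have h3 : (fun s => v s z - v s 0) =ᶠ[𝓝 t] fun s => ∫ y in (0:ℝ)..z, v' s y := by
      filter_upwards [Metric.closedBall_mem_nhds t hε] with s hs
      exact (intervalIntegral.integral_eq_sub_of_hasDerivAt (fun y _ => hv s hs y)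
        ((hv' s hs).intervalIntegrable _ _)).symm
    have := h2.unique (h1.congr_of_eventuallyEq h3)
    linarith
  have : vt t = fun z => vt t 0 + ∫ y in (0:ℝ)..z, w t y := funext key
  rw [this]
  exact (intervalIntegral.integral_hasDerivAt_right (hwt.intervalIntegrable _ _)
      (hwt.stronglyMeasurableAtFilter _ _) hwt.continuousAt).const_add _

lemma left_deriv (φ : ℝ → ℝ) (φ' c K t : ℝ) (ht : 0 < t) (hd : HasDerivAt φ φ' t)
    (hle : ∀ s ∈ Set.Icc 0 t, φ s ≤ c * exp (K * s)) (heq : φ t = c * exp (K * t)) :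
    K * (c * exp (K * t)) ≤ φ' := by
  have h1 : HasDerivAt (fun s => φ s - c * exp (K * s)) (φ' - c * (exp (K * t) * K)) t := by
    have : HasDerivAt (fun s => K * s) K t := by simpa using! (hasDerivAt_id t).const_mul K
    exact hd.sub (this.exp.const_mul c)
  have h2 := (hasDerivWithinAt_iff_tendsto_slope' (s := Set.Iio t) (by simp)).1
    h1.hasDerivWithinAt
  have h3 : 0 ≤ φ' - c * (exp (K * t) * K) := by
    refine ge_of_tendsto h2 ?_
    have : Set.Ioo 0 t ∈ 𝓝[<] t := Ioo_mem_nhdsLT ht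
    filter_upwards [this] with s hs
    rw [slope_def_field]
    apply div_nonneg_of_nonpos
    · have := hle s ⟨hs.1.le, hs.2.le⟩
      linarith
    · linarith [hs.2]
  linarith

/-- The coercive barrier `e^{-θx} + δ e^{θx}`. -/
noncomputable def psi (θ δ x : ℝ) : ℝ := exp (-(θ * x)) + δ * exp (θ * x)

lemma psi_pos (θ δ x : ℝ) (hδ : 0 < δ) : 0 < psi θ δ x := by
  unfold psi; positivity

lemma psi_coercive (θ δ C : ℝ) (hθ : 0 < θ) (hδ : 0 < δ) :
    ∃ X : ℝ, ∀ x, X ≤ |x| → C ≤ psi θ δ x := by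
  set m := min 1 δ with hm
  have hm0 : 0 < m := lt_min one_pos hδ
  refine ⟨C / (m * θ), fun x hx => ?_⟩
  rw [div_le_iff₀ (by positivity)] at hx
  have h1 : m * (θ * |x|) ≤ m * exp (θ * |x|) :=
    mul_le_mul_of_nonneg_left (by linarith [add_one_le_exp (θ * |x|)]) hm0.le
  have h2 : m * exp (θ * |x|) ≤ psi θ δ x := by
    unfold psi
    have e1 := exp_pos (θ * x)
    have e2 := exp_pos (-(θ * x))
    rcases abs_cases x with ⟨h, _⟩ | ⟨h, _⟩ <;> rw [h]
    · have := mul_le_mul_of_nonneg_right (min_le_right 1 δ) e1.le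
      linarith
    · rw [mul_neg]
      have := mul_le_mul_of_nonneg_right (min_le_left 1 δ) e2.le
      have := mul_pos hδ e1
      linarith
  nlinarith

lemma psi_deriv (θ δ x : ℝ) (h0 : 0 < θ) (h1 : θ < 1) (hδ : 0 < δ) :
    ∃ d, HasDerivAt (psi θ δ) d x ∧ |d| ≤ psi θ δ x := by
  have a1 : HasDerivAt (fun s => θ * s) θ x := by simpa using! (hasDerivAt_id x).const_mul θ
  refine ⟨_, (a1.neg.exp.add (a1.exp.const_mul δ)), ?_⟩
  unfold psi
  have e1 := mul_pos hδ (exp_pos (θ * x))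
  have e2 := exp_pos (-(θ * x))
  simp only [Pi.neg_apply]
  rw [abs_le]
  constructor <;> nlinarith

lemma fLoc_bound (n : ℕ) (hn : 0 < n) (u : ℝ → ℝ → ℝ) (t x M B : ℝ)
    (hM : |u t x| + |ux u t x| ≤ M) (hu : |u t x| ≤ B) (hux : |ux u t x| ≤ B) :
    |fLoc n u t x| ≤ ((n : ℝ) / 2 * M ^ n
      + (n : ℝ) * ((n : ℝ) + 3) / (2 * ((n : ℝ) + 1)) * M ^ n) * B := by
  have a0 := abs_nonneg (u t x)
  have b0 := abs_nonneg (ux u t x)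
  have hM0 : 0 ≤ M := by linarith
  have hB : 0 ≤ B := a0.trans hu
  unfold fLoc
  refine (abs_add_le _ _).trans ?_
  rw [add_mul]
  have k1 : |u t x| ^ (n - 1) * |ux u t x| ^ 2 ≤ M ^ n * B := by
    calc _ = |u t x| ^ (n - 1) * |ux u t x| * |ux u t x| := by ring
      _ ≤ M ^ (n - 1) * M * B := by gcongr <;> linarith
      _ = _ := by rw [← pow_succ, Nat.sub_add_cancel hn]
  have k2 : |u t x| ^ (n + 1) ≤ M ^ n * B := by
    rw [pow_succ]; gcongr; linarith
  refine add_le_add ?_ ?_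
  · rw [abs_mul, abs_mul, abs_pow, abs_pow, abs_of_nonneg (by positivity : 0 ≤ (n : ℝ) / 2),
      mul_assoc, mul_assoc]
    gcongr
  · rw [abs_mul, abs_pow,
      abs_of_nonneg (by positivity : 0 ≤ (n : ℝ) * ((n : ℝ) + 3) / (2 * ((n : ℝ) + 1))), mul_assoc]
    gcongr

lemma rates (n : ℕ) (hn : 0 < n) (T : ℝ≥0∞) (u : ℝ → ℝ → ℝ)
    (hu : IsClassicalSolution n T u) (θ δ M D Cf : ℝ) (h0 : 0 < θ) (h1 : θ < 1) (hδ : 0 < δ)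
    (hD : 0 ≤ D)
    (hCf : Cf = (n : ℝ) / 2 * M ^ n + (n : ℝ) * ((n : ℝ) + 3) / (2 * ((n : ℝ) + 1)) * M ^ n)
    (t : ℝ) (ht : 0 < t) (htT : ENNReal.ofReal t < T)
    (hM : ∀ x, |u t x| + |ux u t x| ≤ M)
    (hb : ∀ x, |u t x| ≤ D * psi θ δ x) (hbx : ∀ x, |ux u t x| ≤ D * psi θ δ x) (x : ℝ) :
    |ut u t x| ≤ (M ^ n + Cf / (1 - θ)) * (D * psi θ δ x) ∧
    |utx u t x| ≤ (n * M ^ n + Cf / (1 - θ) + Cf) * (D * psi θ δ x) + M ^ n * |uxx u t x| := by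
  have htd : t ∈ timeDomain T := ⟨ht.le, htT⟩
  have cu : ContDiff ℝ 3 (u t) := hu.contDiff_x t htd
  have dux : ∀ s ∈ timeDomain T, ∀ y, HasDerivAt (u s) (ux u s y) y := fun s hs y =>
    ((hu.contDiff_x s hs).differentiable (by norm_num) y).hasDerivAt
  have cux2 : ∀ s ∈ timeDomain T, ContDiff ℝ 2 (ux u s) := fun s hs => by
    have : ContDiff ℝ (2 + 1) (u s) := by simpa [show (2:WithTop ℕ∞) + 1 = 3 by norm_num] using hu.contDiff_x s hs
    exact (contDiff_succ_iff_deriv.1 this).2.2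
  have duxx : HasDerivAt (ux u t) (uxx u t x) x :=
    ((cux2 t htd).differentiable (by norm_num) x).hasDerivAt
  have cont : Continuous (u t) := cu.continuous
  have contx : Continuous (ux u t) := (cux2 t htd).continuous
  have a0 : ∀ y, 0 ≤ |u t y| := fun y => abs_nonneg _
  have b0 : ∀ y, 0 ≤ |ux u t y| := fun y => abs_nonneg _
  have hM0 : 0 ≤ M := by linarith [hM 0, a0 0, b0 0]
  have hCf0 : 0 ≤ Cf := by rw [hCf]; positivity
  have hfb : ∀ y, |fLoc n u t y| ≤ Cf * (D * psi θ δ y) := fun y => by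
    rw [hCf]; exact fLoc_bound n hn u t y M _ (hM y) (hb y) (hbx y)
  have hfc : Continuous (fLoc n u t) := by unfold fLoc; fun_prop
  obtain ⟨G, G', hG, hGz⟩ := conv_facts (fLoc n u t) hfc θ (Cf * D) (Cf * D * δ) h0 h1
    (by positivity) (by positivity) (fun y => by
      refine (hfb y).trans (le_of_eq ?_); unfold psi; ring)
  have hpe : ∀ z, (Cf * D * exp (-(θ * z)) + Cf * D * δ * exp (θ * z)) / (1 - θ)
      = Cf / (1 - θ) * (D * psi θ δ z) := by
    intro z; unfold psi; ring
  have hF : ∀ z, FLoc n u t z = G' z := by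
    intro z; unfold FLoc; rw [hG]; exact (hGz z).1.deriv
  have hut : ∀ z, ut u t z = -(u t z ^ n * ux u t z + G' z) := by
    intro z; have := hu.nonlocal t htd z; rw [hF] at this; linarith
  obtain ⟨-, dG', bG, bG'⟩ := hGz x
  rw [hpe] at bG bG'
  have hun : |u t x| ^ n ≤ M ^ n := by gcongr; linarith [hM x, b0 x]
  have hψ : 0 ≤ D * psi θ δ x := mul_nonneg hD (psi_pos θ δ x hδ).le
  constructor
  · rw [hut, abs_neg, add_mul]
    refine (abs_add_le _ _).trans (add_le_add ?_ bG')
    rw [abs_mul, abs_pow]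
    exact mul_le_mul hun (hbx x) (b0 x) (by positivity)
  · -- swap
    have hopen : ∃ ε > 0, Metric.closedBall t ε ⊆ timeDomain T := by
      have : timeDomain T ∈ 𝓝 t := by
        have h2 : ∀ᶠ s in 𝓝 t, ENNReal.ofReal s < T :=
          ENNReal.continuous_ofReal.continuousAt.eventually_lt_const htT
        filter_upwards [h2, lt_mem_nhds ht] with s hs hs'
        exact ⟨hs'.le, hs⟩
      exact Metric.nhds_basis_closedBall.mem_iff.1 this
    obtain ⟨ε, hε, hsub⟩ := hopen
    have hsw := swap_deriv u (ux u) (ut u) (utx u) t ε hε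
      (fun s hs y => dux s (hsub hs) y) (fun s hs => (cux2 s (hsub hs)).continuous)
      (fun y => (hu.diff_t y t htd).hasDerivAt)
      (fun s hs y => (hu.diff_tx y s (hsub hs)).hasDerivAt)
      (hu.cont_utx.mono (Set.prod_mono hsub subset_rfl)) x
    have hfun : ut u t = fun z => -(u t z ^ n * ux u t z + G' z) := funext hut
    have h2 : HasDerivAt (ut u t) (-((n * u t x ^ (n - 1) * ux u t x) * ux u t x
        + u t x ^ n * uxx u t x + (G x - fLoc n u t x))) x := by
      rw [hfun]
      exact ((((dux t htd x).pow n).mul duxx).add dG').neg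
    have heq := hsw.unique h2
    rw [heq, abs_neg]
    have t1 : |(n * u t x ^ (n - 1) * ux u t x) * ux u t x| ≤ n * M ^ n * (D * psi θ δ x) := by
      rw [abs_mul, abs_mul, abs_mul, abs_pow, Nat.abs_cast]
      calc _ ≤ n * M ^ (n - 1) * M * (D * psi θ δ x) := by
            gcongr
            · linarith [hM x, b0 x]
            · linarith [hM x, a0 x]
            · exact hbx x
        _ = n * (M ^ (n - 1) * M) * (D * psi θ δ x) := by ring
        _ = _ := by rw [← pow_succ, Nat.sub_add_cancel hn]
    have t2 : |u t x ^ n * uxx u t x| ≤ M ^ n * |uxx u t x| := by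
      rw [abs_mul, abs_pow]; gcongr
    have t3 : |G x - fLoc n u t x| ≤ _ := (abs_sub _ _).trans (add_le_add bG (hfb x))
    have s1 := abs_add_le ((n * u t x ^ (n - 1) * ux u t x) * ux u t x + u t x ^ n * uxx u t x)
      (G x - fLoc n u t x)
    have s2 := abs_add_le ((n * u t x ^ (n - 1) * ux u t x) * ux u t x) (u t x ^ n * uxx u t x)
    linarith

lemma barrier (n : ℕ) (hn : 0 < n) (T : ℝ≥0∞) (u : ℝ → ℝ → ℝ)
    (hu : IsClassicalSolution n T u) (T₀ θ δ M S Cf K : ℝ) (hT₀T : ENNReal.ofReal T₀ < T)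
    (h0 : 0 < θ) (h1 : θ < 1) (hδ : 0 < δ) (hS : 0 < S)
    (hM : ∀ t ∈ Set.Icc (0 : ℝ) T₀, ∀ x : ℝ, |u t x| + |ux u t x| ≤ M)
    (hCf : Cf = (n : ℝ) / 2 * M ^ n + (n : ℝ) * ((n : ℝ) + 3) / (2 * ((n : ℝ) + 1)) * M ^ n)
    (hK : K = ((n : ℝ) + 1) * M ^ n + Cf / (1 - θ) + Cf + 1)
    (hi : ∀ x, |u 0 x| ≤ S * exp (-(θ * x))) (hix : ∀ x, |ux u 0 x| ≤ S * exp (-(θ * x)))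
    (t : ℝ) (ht : t ∈ Set.Icc 0 T₀) (x : ℝ) :
    max |u t x| |ux u t x| ≤ S * psi θ δ x * exp (K * t) := by
  have hdom : ∀ s ∈ Set.Icc (0:ℝ) T₀, s ∈ timeDomain T := fun s hs =>
    ⟨hs.1, (ENNReal.ofReal_le_ofReal hs.2).trans_lt hT₀T⟩
  have hM0 : 0 ≤ M := by linarith [hM t ht x, abs_nonneg (u t x), abs_nonneg (ux u t x)]
  have hCf0 : 0 ≤ Cf := by rw [hCf]; positivity
  have hθ' : 0 < 1 - θ := by linarith
  have hK0 : 0 ≤ K := by rw [hK]; positivity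
  have cux : ∀ s ∈ timeDomain T, ContDiff ℝ 2 (ux u s) := fun s hs => by
    have : ContDiff ℝ (2 + 1) (u s) := by simpa [show (2:WithTop ℕ∞) + 1 = 3 by norm_num] using hu.contDiff_x s hs
    exact (contDiff_succ_iff_deriv.1 this).2.2
  by_contra hcon
  push Not at hcon
  set Z : ℝ × ℝ → ℝ := fun p => max |u p.1 p.2| |ux u p.1 p.2| / (psi θ δ p.2 * exp (K * p.1)) with hZ
  have hden : ∀ s y, 0 < psi θ δ y * exp (K * s) := fun s y =>
    mul_pos (psi_pos θ δ y hδ) (exp_pos _)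
  have hZt : S < Z (t, x) := by
    simp only [hZ]; rw [lt_div_iff₀ (hden t x)]; linarith
  obtain ⟨X₀, hX₀⟩ := psi_coercive θ δ (M / S) h0 hδ
  set X := max X₀ |x| with hX
  have hcont : ContinuousOn Z (Set.Icc (0 : ℝ) T₀ ×ˢ Set.Icc (-X) X) := by
    have c1 := joint_cont u (ut u) T₀ X (fun s hs => (hu.contDiff_x s (hdom s hs)).continuous)
      (fun y s hs => (hu.diff_t y s (hdom s hs)).hasDerivAt)
      (hu.cont_ut.mono (Set.prod_mono hdom subset_rfl))
    have c2 := joint_cont (ux u) (utx u) T₀ X (fun s hs => (cux s (hdom s hs)).continuous)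
      (fun y s hs => (hu.diff_tx y s (hdom s hs)).hasDerivAt)
      (hu.cont_utx.mono (Set.prod_mono hdom subset_rfl))
    refine (ContinuousOn.sup c1.abs c2.abs).div ?_ (fun p _ => (hden p.1 p.2).ne')
    unfold psi
    fun_prop
  have hxX : x ∈ Set.Icc (-X) X := abs_le.1 (le_max_right _ _)
  obtain ⟨⟨t₀, x₀⟩, ⟨ht₀, hx₀⟩, hmax⟩ := (isCompact_Icc.prod isCompact_Icc).exists_isMaxOn
    ⟨(t, x), ⟨ht, hxX⟩⟩ hcont
  simp only at ht₀ hx₀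
  set A := Z (t₀, x₀) with hA
  have hSA : S < A := hZt.trans_le (hmax ⟨ht, hxX⟩)
  have hglob : ∀ s ∈ Set.Icc (0:ℝ) T₀, ∀ y, Z (s, y) ≤ A := by
    intro s hs y
    by_cases hy : y ∈ Set.Icc (-X) X
    · exact hmax ⟨hs, hy⟩
    · refine le_trans ?_ hSA.le
      have hy' : X < |y| := by
        by_contra h; exact hy (abs_le.1 (not_lt.1 h))
      have h2 := hX₀ y ((le_max_left _ _).trans hy'.le)
      rw [div_le_iff₀ hS] at h2
      simp only [hZ]
      rw [div_le_iff₀ (hden s y)]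
      have h3 : max |u s y| |ux u s y| ≤ M := by
        have := hM s hs y
        have := abs_nonneg (u s y)
        have := abs_nonneg (ux u s y)
        exact max_le (by linarith) (by linarith)
      have h4 : 1 ≤ exp (K * s) := one_le_exp (mul_nonneg hK0 hs.1)
      have := psi_pos θ δ y hδ
      calc _ ≤ M := h3
        _ ≤ psi θ δ y * S := h2
        _ ≤ psi θ δ y * S * exp (K * s) := le_mul_of_one_le_right (by positivity) h4
        _ = _ := by ring
  have hA0 : 0 < A := hS.trans hSA
  have hmx : ∀ s ∈ Set.Icc (0:ℝ) T₀, ∀ y,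
      max |u s y| |ux u s y| ≤ A * psi θ δ y * exp (K * s) := by
    intro s hs y
    have := hglob s hs y
    simp only [hZ] at this
    rw [div_le_iff₀ (hden s y)] at this
    linarith
  have hu1 : ∀ s ∈ Set.Icc (0:ℝ) T₀, ∀ y, |u s y| ≤ A * psi θ δ y * exp (K * s) :=
    fun s hs y => (le_max_left _ _).trans (hmx s hs y)
  have hu2 : ∀ s ∈ Set.Icc (0:ℝ) T₀, ∀ y, |ux u s y| ≤ A * psi θ δ y * exp (K * s) :=
    fun s hs y => (le_max_right _ _).trans (hmx s hs y)
  have hAeq : max |u t₀ x₀| |ux u t₀ x₀| = A * psi θ δ x₀ * exp (K * t₀) := by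
    have : A = max |u t₀ x₀| |ux u t₀ x₀| / (psi θ δ x₀ * exp (K * t₀)) := rfl
    rw [eq_div_iff (hden t₀ x₀).ne'] at this
    linarith
  have ht₀pos : 0 < t₀ := by
    rcases ht₀.1.lt_or_eq with h | h
    · exact h
    · exfalso
      rw [← h] at hAeq
      have hle : max |u 0 x₀| |ux u 0 x₀| ≤ S * psi θ δ x₀ := by
        have : S * exp (-(θ * x₀)) ≤ S * psi θ δ x₀ := by
          unfold psi
          have := mul_pos hδ (exp_pos (θ * x₀))
          gcongr; linarith
        exact max_le ((hi x₀).trans this) ((hix x₀).trans this)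
      rw [hAeq, mul_zero, exp_zero, mul_one] at hle
      exact absurd (le_of_mul_le_mul_right hle (psi_pos θ δ x₀ hδ)) (not_le.2 hSA)
  set D := A * exp (K * t₀) with hD
  have hD0 : 0 < D := mul_pos hA0 (exp_pos _)
  have e1 : ∀ y, A * psi θ δ y * exp (K * t₀) = D * psi θ δ y := fun y => by rw [hD]; ring
  have hr := rates n hn T u hu θ δ M D Cf h0 h1 hδ hD0.le hCf t₀ ht₀pos (hdom t₀ ht₀).2
    (hM t₀ ht₀) (fun y => (hu1 t₀ ht₀ y).trans (e1 y).le) (fun y => (hu2 t₀ ht₀ y).trans (e1 y).le) x₀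
  have hψ : 0 < D * psi θ δ x₀ := mul_pos hD0 (psi_pos θ δ x₀ hδ)
  have sgn : ∀ r : ℝ, ∃ s : ℝ, |s| = 1 ∧ s * r = |r| := by
    intro r
    rcases abs_cases r with ⟨h, _⟩ | ⟨h, _⟩
    · exact ⟨1, by simp, by rw [h]; ring⟩
    · exact ⟨-1, by simp, by rw [h]; ring⟩
  have sgnle : ∀ s r : ℝ, |s| = 1 → s * r ≤ |r| := by
    intro s r h
    calc _ ≤ |s * r| := le_abs_self _
      _ = _ := by rw [abs_mul, h, one_mul]
  have hMn : 0 ≤ M ^ n := by positivity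
  have hq : 0 ≤ Cf / (1 - θ) := by positivity
  have hn0 : (0:ℝ) ≤ n := Nat.cast_nonneg n
  have hicc : ∀ s ∈ Set.Icc 0 t₀, s ∈ Set.Icc 0 T₀ := fun s hs => ⟨hs.1, hs.2.trans ht₀.2⟩
  rcases max_choice |u t₀ x₀| |ux u t₀ x₀| with hc | hc <;> rw [hc] at hAeq
  · obtain ⟨s, hs, hsr⟩ := sgn (u t₀ x₀)
    have hl := left_deriv (fun τ => s * u τ x₀) (s * ut u t₀ x₀) (A * psi θ δ x₀) K t₀ ht₀pos
      ((hu.diff_t x₀ t₀ (hdom t₀ ht₀)).hasDerivAt.const_mul s)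
      (fun τ hτ => (sgnle s _ hs).trans (hu1 τ (hicc τ hτ) x₀)) (by rw [hsr, hAeq])
    rw [e1] at hl
    have h2 := hl.trans ((sgnle s _ hs).trans hr.1)
    have h3 := le_of_mul_le_mul_right h2 hψ
    nlinarith
  · obtain ⟨s, hs, hsr⟩ := sgn (ux u t₀ x₀)
    have hl := left_deriv (fun τ => s * ux u τ x₀) (s * utx u t₀ x₀) (A * psi θ δ x₀) K t₀ ht₀pos
      ((hu.diff_tx x₀ t₀ (hdom t₀ ht₀)).hasDerivAt.const_mul s)
      (fun τ hτ => (sgnle s _ hs).trans (hu2 τ (hicc τ hτ) x₀)) (by rw [hsr, hAeq])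
    rw [e1] at hl
    obtain ⟨d, hd, hdb⟩ := psi_deriv θ δ x₀ h0 h1 hδ
    have hxx : HasDerivAt (ux u t₀) (uxx u t₀ x₀) x₀ :=
      ((cux t₀ (hdom t₀ ht₀)).differentiable (by norm_num) x₀).hasDerivAt
    have hloc : IsLocalMax (fun y => s * ux u t₀ y - D * psi θ δ y) x₀ := by
      refine Eventually.of_forall fun y => ?_
      have q1 := (sgnle s (ux u t₀ y) hs).trans ((hu2 t₀ ht₀ y).trans (e1 y).le)
      simp only
      rw [hsr, hAeq, e1]
      linarith
    have hz := hloc.hasDerivAt_eq_zero ((hxx.const_mul s).sub (hd.const_mul D))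
    have hux : |uxx u t₀ x₀| ≤ D * psi θ δ x₀ := by
      have : |s * uxx u t₀ x₀| = |D * d| := by congr 1; linarith
      rw [abs_mul, hs, one_mul, abs_mul, abs_of_pos hD0] at this
      rw [this]; gcongr
    have h2 := hl.trans ((sgnle s _ hs).trans hr.2)
    have h5 := mul_le_mul_of_nonneg_left hux hMn
    have h3 : K * (D * psi θ δ x₀)
        ≤ (n * M ^ n + Cf / (1 - θ) + Cf + M ^ n) * (D * psi θ δ x₀) := by linarith
    have h4 := le_of_mul_le_mul_right h3 hψ
    linarith

lemma init_bound (w : ℝ → ℝ) (θ M : ℝ) (h0 : 0 < θ) (hM : ∀ x, |w x| ≤ M)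
    (h : ∃ C : ℝ, ∀ᶠ x in atTop, Real.exp (θ * x) * |w x| ≤ C) :
    ∃ S : ℝ, 0 < S ∧ ∀ x, |w x| ≤ S * exp (-(θ * x)) := by
  obtain ⟨C, hC⟩ := h
  obtain ⟨X, hX⟩ := eventually_atTop.1 hC
  have hM0 : 0 ≤ M := (abs_nonneg _).trans (hM 0)
  have key : ∀ x, exp (θ * x) * |w x| ≤ |C| + exp (θ * X) * M + 1 := by
    intro x
    have p : 0 ≤ exp (θ * X) * M := by positivity
    rcases le_total X x with hx | hx
    · linarith [hX x hx, le_abs_self C]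
    · have : exp (θ * x) * |w x| ≤ exp (θ * X) * M := by
        gcongr; exact hM x
      linarith [abs_nonneg C]
  refine ⟨|C| + exp (θ * X) * M + 1, by positivity, fun x => ?_⟩
  · have := mul_le_mul_of_nonneg_right (key x) (exp_pos (-(θ * x))).le
    refine le_trans (le_of_eq ?_) this
    rw [mul_right_comm, ← exp_add]; simp

/-- Persistence of the exponential decay rate `e^{-θx}` as `x → ∞`,
uniformly on `[0, T₀]`. -/
theorem persistence_of_exponential_decay
    (n : ℕ) (hn : 0 < n) (T : ℝ≥0∞) (hT : 0 < T) (u : ℝ → ℝ → ℝ)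
    (hu : IsClassicalSolution n T u)
    (T₀ : ℝ) (hT₀ : 0 < T₀) (hT₀T : ENNReal.ofReal T₀ < T)
    (θ : ℝ) (hθ : θ ∈ Set.Ioo (0 : ℝ) 1)
    (hu0 : ∃ C : ℝ, ∀ᶠ x in atTop, Real.exp (θ * x) * |u 0 x| ≤ C)
    (hu0' : ∃ C : ℝ, ∀ᶠ x in atTop, Real.exp (θ * x) * |ux u 0 x| ≤ C) :
    ∃ L : ℝ, 0 ≤ L ∧ ∀ t ∈ Set.Icc (0 : ℝ) T₀, ∀ x : ℝ, 0 ≤ x →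
      Real.exp (θ * x) * (|u t x| + |ux u t x|) ≤ L := by
  obtain ⟨h0, h1⟩ := hθ
  obtain ⟨M, hM⟩ := hu.sup_bound T₀ ⟨hT₀.le, hT₀T⟩
  have hz : (0:ℝ) ∈ Set.Icc 0 T₀ := ⟨le_rfl, hT₀.le⟩
  obtain ⟨S₁, hS₁, hi₁⟩ := init_bound (u 0) θ M h0
    (fun x => by linarith [hM 0 hz x, abs_nonneg (ux u 0 x)]) hu0
  obtain ⟨S₂, hS₂, hi₂⟩ := init_bound (ux u 0) θ M h0
    (fun x => by linarith [hM 0 hz x, abs_nonneg (u 0 x)]) hu0'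
  have hM0 : 0 ≤ M := by linarith [hM 0 hz 0, abs_nonneg (u 0 0), abs_nonneg (ux u 0 0)]
  obtain ⟨Cf, hCf⟩ : ∃ Cf : ℝ, Cf = (n : ℝ) / 2 * M ^ n
    + (n : ℝ) * ((n : ℝ) + 3) / (2 * ((n : ℝ) + 1)) * M ^ n := ⟨_, rfl⟩
  obtain ⟨K, hK⟩ : ∃ K : ℝ, K = ((n : ℝ) + 1) * M ^ n + Cf / (1 - θ) + Cf + 1 := ⟨_, rfl⟩
  have hCf0 : 0 ≤ Cf := by rw [hCf]; positivity
  have hθ' : 0 < 1 - θ := by linarith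
  have hK0 : 0 ≤ K := by rw [hK]; positivity
  have hS : 0 < S₁ + S₂ := by positivity
  refine ⟨2 * ((S₁ + S₂) * exp (K * T₀)), by positivity, fun t ht x _ => ?_⟩
  have hb : ∀ δ > 0, max |u t x| |ux u t x| ≤ (S₁ + S₂) * psi θ δ x * exp (K * t) := fun δ hδ =>
    barrier n hn T u hu T₀ θ δ M (S₁ + S₂) Cf K hT₀T h0 h1 hδ hS hM hCf hK
      (fun y => (hi₁ y).trans (by gcongr; linarith))
      (fun y => (hi₂ y).trans (by gcongr; linarith)) t ht x
  have hlim : max |u t x| |ux u t x| ≤ (S₁ + S₂) * psi θ 0 x * exp (K * t) := by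
    have hc : Continuous (fun δ => (S₁ + S₂) * psi θ δ x * exp (K * t)) := by
      unfold psi; fun_prop
    refine ge_of_tendsto (hc.continuousWithinAt (s := Set.Ioi 0) (x := 0)) ?_
    filter_upwards [self_mem_nhdsWithin] with δ hδ
    exact hb δ hδ
  have hKt : exp (K * t) ≤ exp (K * T₀) := exp_le_exp.2 (mul_le_mul_of_nonneg_left ht.2 hK0)
  have hp : exp (θ * x) * psi θ 0 x = 1 := by
    unfold psi; rw [zero_mul, add_zero, ← exp_add]; simp
  have h5 : exp (θ * x) * max |u t x| |ux u t x| ≤ (S₁ + S₂) * exp (K * T₀) := by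
    calc _ ≤ exp (θ * x) * ((S₁ + S₂) * psi θ 0 x * exp (K * t)) := by gcongr
      _ = (exp (θ * x) * psi θ 0 x) * ((S₁ + S₂) * exp (K * t)) := by ring
      _ ≤ _ := by rw [hp, one_mul]; gcongr
  have h6 : |u t x| + |ux u t x| ≤ 2 * max |u t x| |ux u t x| := by
    linarith [le_max_left |u t x| |ux u t x|, le_max_right |u t x| |ux u t x|]
  have h7 := mul_le_mul_of_nonneg_left h6 (exp_pos (θ * x)).le
  linarith
end

section
/- Let n be an odd positive integer and let u be a classical solution of (CH_n) on [0,T). Assume: (i) for some α ∈ (1/(n+1), 1), e^{x}|u(0,x)| → 0 and e^{αx}|u_x(0,x)| remains bounded as x → ∞; (ii) there exists t₁ ∈ (0,T) such that e^{x}|u(t₁,x)| → 0 as x → ∞. Then u(t,x) = 0 for all (t,x) ∈ [0,T) × ℝ. -/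
open Real MeasureTheory Filter Topology
open scoped ENNReal

/-! ### Green function representation -/

noncomputable def PP (h : ℝ → ℝ) (x : ℝ) : ℝ := ∫ y in Set.Iic x, Real.exp y * h y
noncomputable def QQ (h : ℝ → ℝ) (x : ℝ) : ℝ := ∫ y in Set.Ioi x, Real.exp (-y) * h y
noncomputable def GG (h : ℝ → ℝ) (x : ℝ) : ℝ :=
  Real.exp (-x) / 2 * PP h x + Real.exp x / 2 * QQ h x
noncomputable def FF (h : ℝ → ℝ) (x : ℝ) : ℝ :=
  -(Real.exp (-x) / 2 * PP h x) + Real.exp x / 2 * QQ h x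

lemma integrableOn_PP {h : ℝ → ℝ} (hi : Integrable h) (x : ℝ) :
    IntegrableOn (fun y => Real.exp y * h y) (Set.Iic x) := by
  refine Integrable.bdd_mul (c := Real.exp x) hi.integrableOn
    (Real.continuous_exp.aestronglyMeasurable) ?_
  refine (ae_restrict_iff' measurableSet_Iic).2 (Eventually.of_forall fun y hy => ?_)
  rw [Real.norm_eq_abs, abs_of_pos (Real.exp_pos _)]
  exact Real.exp_le_exp.2 hy

lemma integrableOn_QQ {h : ℝ → ℝ} (hi : Integrable h) (x : ℝ) :
    IntegrableOn (fun y => Real.exp (-y) * h y) (Set.Ioi x) := by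
  refine Integrable.bdd_mul (c := Real.exp (-x)) hi.integrableOn
    ((Real.continuous_exp.comp continuous_neg).aestronglyMeasurable) ?_
  refine (ae_restrict_iff' measurableSet_Ioi).2 (Eventually.of_forall fun y hy => ?_)
  rw [Real.norm_eq_abs, abs_of_pos (Real.exp_pos _)]
  exact Real.exp_le_exp.2 (neg_le_neg (le_of_lt hy))

lemma hasDerivAt_PP {h : ℝ → ℝ} (hc : Continuous h) (hi : Integrable h) (x : ℝ) :
    HasDerivAt (PP h) (Real.exp x * h x) x := by
  have e : PP h = fun z => PP h 0 + ∫ y in (0:ℝ)..z, Real.exp y * h y := by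
    funext z
    have := intervalIntegral.integral_Iic_sub_Iic (integrableOn_PP hi 0) (integrableOn_PP hi z)
    simp only [PP]; linarith
  rw [e]
  have hcc : Continuous fun y => Real.exp y * h y := Real.continuous_exp.mul hc
  exact (intervalIntegral.integral_hasDerivAt_right (hcc.intervalIntegrable _ _)
    (hcc.stronglyMeasurableAtFilter _ _) hcc.continuousAt).const_add _

lemma hasDerivAt_QQ {h : ℝ → ℝ} (hc : Continuous h) (hi : Integrable h) (x : ℝ) :
    HasDerivAt (QQ h) (-(Real.exp (-x) * h x)) x := by
  have e : QQ h = fun z => QQ h 0 - ∫ y in (0:ℝ)..z, Real.exp (-y) * h y := by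
    funext z
    have := intervalIntegral.integral_interval_add_Ioi (integrableOn_QQ hi 0) (integrableOn_QQ hi z)
    simp only [QQ]; linarith
  rw [e]
  have hcc : Continuous fun y => Real.exp (-y) * h y :=
    (Real.continuous_exp.comp continuous_neg).mul hc
  exact (intervalIntegral.integral_hasDerivAt_right (hcc.intervalIntegrable _ _)
    (hcc.stronglyMeasurableAtFilter _ _) hcc.continuousAt).const_sub _

lemma hasDerivAt_GG {h : ℝ → ℝ} (hc : Continuous h) (hi : Integrable h) (x : ℝ) :
    HasDerivAt (GG h) (FF h x) x := by
  have h1 : HasDerivAt (fun z : ℝ => Real.exp (-z) / 2) (-(Real.exp (-x) / 2)) x := by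
    have := ((hasDerivAt_neg x).exp).div_const 2
    exact this.congr_deriv (by ring)
  have h2 : HasDerivAt (fun z : ℝ => Real.exp z / 2) (Real.exp x / 2) x :=
    (Real.hasDerivAt_exp x).div_const 2
  have := (h1.mul (hasDerivAt_PP hc hi x)).add (h2.mul (hasDerivAt_QQ hc hi x))
  refine this.congr_deriv ?_
  simp only [FF]; ring

lemma hasDerivAt_FF {h : ℝ → ℝ} (hc : Continuous h) (hi : Integrable h) (x : ℝ) :
    HasDerivAt (FF h) (GG h x - h x) x := by
  have h1 : HasDerivAt (fun z : ℝ => Real.exp (-z) / 2) (-(Real.exp (-x) / 2)) x := by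
    have := ((hasDerivAt_neg x).exp).div_const 2
    exact this.congr_deriv (by ring)
  have h2 : HasDerivAt (fun z : ℝ => Real.exp z / 2) (Real.exp x / 2) x :=
    (Real.hasDerivAt_exp x).div_const 2
  have := (h1.mul (hasDerivAt_PP hc hi x)).neg.add (h2.mul (hasDerivAt_QQ hc hi x))
  refine this.congr_deriv ?_
  have e : Real.exp x * Real.exp (-x) = 1 := by rw [← Real.exp_add]; simp
  simp only [GG]
  linear_combination (-h x) * e

lemma green_eq {h : ℝ → ℝ} (hi : Integrable h) (z : ℝ) :
    ∫ y : ℝ, g (z - y) * h y = GG h z := by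
  have e1 : ∀ y ∈ Set.Iic z, g (z - y) * h y = Real.exp (-z) / 2 * (Real.exp y * h y) := by
    intro y hy
    have hy' : y ≤ z := hy
    simp only [g]
    rw [abs_of_nonneg (by linarith), show -(z - y) = -z + y by ring, Real.exp_add]; ring
  have e2 : ∀ y ∈ Set.Ioi z, g (z - y) * h y = Real.exp z / 2 * (Real.exp (-y) * h y) := by
    intro y hy
    have hy' : z < y := hy
    simp only [g]
    rw [abs_of_neg (by linarith), show - -(z - y) = z + -y by ring, Real.exp_add]; ring
  have i1 : IntegrableOn (fun y => g (z - y) * h y) (Set.Iic z) :=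
    IntegrableOn.congr_fun ((integrableOn_PP hi z).const_mul _) (fun y hy => (e1 y hy).symm)
      measurableSet_Iic
  have i2 : IntegrableOn (fun y => g (z - y) * h y) (Set.Ioi z) :=
    IntegrableOn.congr_fun ((integrableOn_QQ hi z).const_mul _) (fun y hy => (e2 y hy).symm)
      measurableSet_Ioi
  rw [← intervalIntegral.integral_Iic_add_Ioi i1 i2, setIntegral_congr_fun measurableSet_Iic e1,
    setIntegral_congr_fun measurableSet_Ioi e2, integral_const_mul, integral_const_mul]
  rfl

lemma PP_nonneg {h : ℝ → ℝ} (h0 : ∀ y, 0 ≤ h y) (x : ℝ) : 0 ≤ PP h x :=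
  integral_nonneg fun y => mul_nonneg (Real.exp_pos _).le (h0 y)

lemma QQ_nonneg {h : ℝ → ℝ} (h0 : ∀ y, 0 ≤ h y) (x : ℝ) : 0 ≤ QQ h x :=
  integral_nonneg fun y => mul_nonneg (Real.exp_pos _).le (h0 y)

lemma QQ_le_aux {a : ℝ} (ha : 0 ≤ a) (x : ℝ) :
    IntegrableOn (fun y => Real.exp (-y) * Real.exp (-a * y)) (Set.Ioi x) ∧
    ∫ y in Set.Ioi x, Real.exp (-y) * Real.exp (-a * y) ≤ Real.exp (-x) * Real.exp (-a * x) := by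
  have e : (fun y : ℝ => Real.exp (-y) * Real.exp (-a * y)) = fun y => Real.exp ((-(1 + a)) * y) := by
    funext y; rw [← Real.exp_add]; ring_nf
  have e' := congrFun e x
  rw [e, e']
  refine ⟨integrableOn_exp_mul_Ioi (by linarith) x, ?_⟩
  rw [integral_exp_mul_Ioi (by linarith), neg_div_neg_eq]
  exact div_le_self (Real.exp_pos _).le (by linarith)

lemma PP_le_aux {a : ℝ} (ha : 0 ≤ a) (ha1 : a < 1) (x : ℝ) :
    IntegrableOn (fun y => Real.exp y * Real.exp (-a * y)) (Set.Iic x) ∧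
    ∫ y in Set.Iic x, Real.exp y * Real.exp (-a * y)
      = (1 / (1 - a)) * (Real.exp x * Real.exp (-a * x)) := by
  have e : (fun y : ℝ => Real.exp y * Real.exp (-a * y)) = fun y => Real.exp ((1 - a) * y) := by
    funext y; rw [← Real.exp_add]; ring_nf
  have e' := congrFun e x
  rw [e, e']
  refine ⟨integrableOn_exp_mul_Iic (by linarith) x, ?_⟩
  rw [integral_exp_mul_Iic (by linarith)]; ring

lemma QQ_le {h : ℝ → ℝ} (hi : Integrable h) {B b : ℝ} (hb : 0 ≤ b) (hB : 0 ≤ B)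
    (hh : ∀ y, h y ≤ B * Real.exp (-b * y)) (x : ℝ) :
    QQ h x ≤ B * (Real.exp (-x) * Real.exp (-b * x)) := by
  obtain ⟨i, l⟩ := QQ_le_aux hb x
  calc QQ h x ≤ ∫ y in Set.Ioi x, B * (Real.exp (-y) * Real.exp (-b * y)) := by
        refine setIntegral_mono (integrableOn_QQ hi x) (i.const_mul B) fun y => ?_
        have := mul_le_mul_of_nonneg_left (hh y) (Real.exp_pos (-y)).le
        simp only; linarith
    _ ≤ _ := by rw [integral_const_mul]; exact mul_le_mul_of_nonneg_left l hB

lemma QQ_le_w {h : ℝ → ℝ} (hi : Integrable h) {B a ε : ℝ} (ha : 0 ≤ a) (hB : 0 ≤ B) (hε : 0 ≤ ε)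
    (hh : ∀ y, h y ≤ B * (Real.exp (-a * y) + ε)) (x : ℝ) :
    Real.exp x * QQ h x ≤ B * (Real.exp (-a * x) + ε) := by
  obtain ⟨i, l⟩ := QQ_le_aux ha x
  have i0 := integrableOn_exp_neg_Ioi x
  have l0 := integral_exp_neg_Ioi x
  have key : QQ h x ≤ B * (Real.exp (-x) * Real.exp (-a * x)) + B * ε * Real.exp (-x) := by
    calc QQ h x ≤ ∫ y in Set.Ioi x, (B * (Real.exp (-y) * Real.exp (-a * y))
            + B * ε * Real.exp (-y)) := by
          refine setIntegral_mono (integrableOn_QQ hi x)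
            ((i.const_mul B).add (i0.const_mul (B * ε))) fun y => ?_
          have := mul_le_mul_of_nonneg_left (hh y) (Real.exp_pos (-y)).le
          simp only; linarith
      _ ≤ _ := by
          rw [integral_add (i.const_mul B) (i0.const_mul (B * ε)), integral_const_mul,
            integral_const_mul, l0]
          have := mul_le_mul_of_nonneg_left l hB
          linarith
  have e : Real.exp x * Real.exp (-x) = 1 := by rw [← Real.exp_add]; simp
  calc Real.exp x * QQ h x ≤ _ := mul_le_mul_of_nonneg_left key (Real.exp_pos x).le
    _ = _ := by linear_combination (B * Real.exp (-a * x) + B * ε) * e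

lemma PP_le_w {h : ℝ → ℝ} (hi : Integrable h) {B a ε : ℝ} (ha : 0 ≤ a) (ha1 : a < 1)
    (hB : 0 ≤ B) (hε : 0 ≤ ε)
    (hh : ∀ y, h y ≤ B * (Real.exp (-a * y) + ε)) (x : ℝ) :
    Real.exp (-x) * PP h x ≤ (1 / (1 - a)) * (B * (Real.exp (-a * x) + ε)) := by
  obtain ⟨i, l⟩ := PP_le_aux ha ha1 x
  have i0 := integrableOn_exp_Iic x
  have l0 := integral_exp_Iic x
  have ha2 : 1 ≤ 1 / (1 - a) := by rw [le_div_iff₀] <;> linarith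
  have key : PP h x ≤ (1 / (1 - a)) * (B * (Real.exp x * Real.exp (-a * x)))
      + B * ε * Real.exp x := by
    calc PP h x ≤ ∫ y in Set.Iic x, (B * (Real.exp y * Real.exp (-a * y))
            + B * ε * Real.exp y) := by
          refine setIntegral_mono (integrableOn_PP hi x)
            ((i.const_mul B).add (i0.const_mul (B * ε))) fun y => ?_
          have := mul_le_mul_of_nonneg_left (hh y) (Real.exp_pos y).le
          simp only; linarith
      _ ≤ _ := by
          rw [integral_add (i.const_mul B) (i0.const_mul (B * ε)), integral_const_mul,
            integral_const_mul, l0, l]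
          apply le_of_eq; ring
  have e : Real.exp x * Real.exp (-x) = 1 := by rw [← Real.exp_add]; simp
  have h3 : B * ε ≤ (1 / (1 - a)) * (B * ε) := le_mul_of_one_le_left (mul_nonneg hB hε) ha2
  calc Real.exp (-x) * PP h x ≤ _ := mul_le_mul_of_nonneg_left key (Real.exp_pos (-x)).le
    _ = (1 / (1 - a)) * (B * Real.exp (-a * x)) + B * ε := by
      linear_combination ((1 / (1 - a)) * (B * Real.exp (-a * x)) + B * ε) * e
    _ ≤ _ := by linarith

lemma FG_bound {h : ℝ → ℝ} (hi : Integrable h) (h0 : ∀ y, 0 ≤ h y)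
    {B a ε : ℝ} (ha : 0 ≤ a) (ha1 : a < 1)
    (hB : 0 ≤ B) (hε : 0 ≤ ε)
    (hh : ∀ y, h y ≤ B * (Real.exp (-a * y) + ε)) (x : ℝ) :
    |FF h x| ≤ (1 / (1 - a)) * (B * (Real.exp (-a * x) + ε)) ∧
    |GG h x| ≤ (1 / (1 - a)) * (B * (Real.exp (-a * x) + ε)) := by
  have p := PP_le_w hi ha ha1 hB hε hh x
  have q := QQ_le_w hi ha hB hε hh x
  have ha2 : 1 ≤ 1 / (1 - a) := by rw [le_div_iff₀] <;> linarith
  have hW : 0 ≤ B * (Real.exp (-a * x) + ε) := by positivity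
  have q' := q.trans (le_mul_of_one_le_left hW ha2)
  have p0 := mul_nonneg (Real.exp_pos (-x)).le (PP_nonneg h0 x)
  have q0 := mul_nonneg (Real.exp_pos x).le (QQ_nonneg h0 x)
  simp only [FF, GG]
  constructor <;> rw [abs_le] <;> constructor <;> linarith

/-! ### Calculus lemmas -/

lemma mvt_lin {φ φ' : ℝ → ℝ} {S : Set ℝ} (hS : Convex ℝ S) {D ε : ℝ}
    (hφ : ∀ r ∈ S, HasDerivAt φ (φ' r) r) (hb : ∀ r ∈ S, |φ' r - D| ≤ ε)
    {x y : ℝ} (hx : x ∈ S) (hy : y ∈ S) : |φ y - φ x - (y - x) * D| ≤ ε * |y - x| := by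
  have := hS.norm_image_sub_le_of_norm_hasDerivWithin_le (f := fun r => φ r - r * D)
    (f' := fun r => φ' r - 1 * D) (C := ε)
    (fun r hr => (((hφ r hr).sub ((hasDerivAt_id r).mul_const D))).hasDerivWithinAt)
    (fun r hr => by simpa using hb r hr) hx hy
  simp only [Real.norm_eq_abs] at this
  convert this using 2; ring

lemma exists_delta {ψ : ℝ → ℝ → ℝ} {a b s x : ℝ} (hs : s ∈ Set.Icc a b)
    (hc : ContinuousOn (fun p : ℝ × ℝ => ψ p.1 p.2) (Set.Icc a b ×ˢ Set.univ))
    {ε : ℝ} (hε : 0 < ε) :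
    ∃ δ > 0, ∀ r ∈ Set.Icc a b ∩ Metric.ball s δ, ∀ y ∈ Metric.ball x δ, |ψ r y - ψ s x| < ε := by
  have := hc (s, x) ⟨hs, trivial⟩
  rw [Metric.continuousWithinAt_iff] at this
  obtain ⟨δ, hδ, H⟩ := this ε hε
  refine ⟨δ, hδ, fun r hr y hy => ?_⟩
  have h1 : dist ((r, y) : ℝ × ℝ) (s, x) < δ := by
    rw [Prod.dist_eq]; exact max_lt hr.2 hy
  exact H (x := (r, y)) ⟨hr.1, trivial⟩ h1

lemma hasDerivWithinAt_along {φ φt : ℝ → ℝ → ℝ} {a b s p q' : ℝ} {q : ℝ → ℝ}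
    (hs : s ∈ Set.Icc a b)
    (ht : ∀ r ∈ Set.Icc a b, ∀ x, HasDerivAt (fun r => φ r x) (φt r x) r)
    (hc : ContinuousOn (fun p : ℝ × ℝ => φt p.1 p.2) (Set.Icc a b ×ˢ Set.univ))
    (hx : HasDerivAt (φ s) p (q s)) (hq : HasDerivWithinAt q q' (Set.Icc a b) s) :
    HasDerivWithinAt (fun r => φ r (q r)) (φt s (q s) + p * q') (Set.Icc a b) s := by
  have h2 : HasDerivWithinAt (fun r => φ s (q r)) (p * q') (Set.Icc a b) s :=
    hx.comp_hasDerivWithinAt s hq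
  have h1 : HasDerivWithinAt (fun r => φ r (q r) - φ s (q r)) (φt s (q s)) (Set.Icc a b) s := by
    rw [hasDerivWithinAt_iff_isLittleO, Asymptotics.isLittleO_iff]
    intro ε hε
    obtain ⟨δ, hδ, H⟩ := exists_delta (x := q s) hs hc hε
    have e1 : ∀ᶠ r in 𝓝[Set.Icc a b] s, q r ∈ Metric.ball (q s) δ :=
      hq.continuousWithinAt (Metric.ball_mem_nhds _ hδ)
    have e2 : ∀ᶠ r in 𝓝[Set.Icc a b] s, r ∈ Metric.ball s δ :=
      mem_nhdsWithin_of_mem_nhds (Metric.ball_mem_nhds _ hδ)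
    filter_upwards [e1, e2, self_mem_nhdsWithin] with r h1 h2 h3
    have := mvt_lin (φ := fun r' => φ r' (q r)) (φ' := fun r' => φt r' (q r))
      ((convex_Icc a b).inter (convex_ball s δ)) (D := φt s (q s)) (ε := ε)
      (fun r' hr' => ht r' hr'.1 (q r)) (fun r' hr' => (H r' hr' _ h1).le)
      (x := s) (y := r) ⟨hs, Metric.mem_ball_self hδ⟩ ⟨h3, h2⟩
    simpa [Real.norm_eq_abs] using this
  have := h1.add h2
  refine this.congr_of_eventuallyEq ?_ ?_
  · exact Eventually.of_forall fun r => by simp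
  · simp

lemma hasDerivAt_symm {φ φx φt ψ : ℝ → ℝ → ℝ} {a b s x : ℝ} (hs : s ∈ Set.Ioo a b)
    (hx : ∀ r ∈ Set.Icc a b, ∀ x, HasDerivAt (φ r) (φx r x) x)
    (ht : ∀ r ∈ Set.Icc a b, ∀ x, HasDerivAt (fun r => φ r x) (φt r x) r)
    (hxt : ∀ r ∈ Set.Icc a b, ∀ x, HasDerivAt (fun r => φx r x) (ψ r x) r)
    (hc : ContinuousOn (fun p : ℝ × ℝ => ψ p.1 p.2) (Set.Icc a b ×ˢ Set.univ)) :
    HasDerivAt (φt s) (ψ s x) x := by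
  have hs' : s ∈ Set.Icc a b := Set.Ioo_subset_Icc_self hs
  rw [hasDerivAt_iff_isLittleO, Asymptotics.isLittleO_iff]
  intro ε hε
  obtain ⟨δ, hδ, H⟩ := exists_delta (x := x) hs' hc hε
  filter_upwards [Metric.ball_mem_nhds x hδ] with x' hx'
  have hd : HasDerivAt (fun r => φ r x' - φ r x - r * ((x' - x) * ψ s x))
      (φt s x' - φt s x - 1 * ((x' - x) * ψ s x)) s :=
    ((ht s hs' x').sub (ht s hs' x)).sub ((hasDerivAt_id s).mul_const _)
  have key := hd.le_of_lip' (C := ε * |x' - x|) (by positivity) ?_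
  · simpa [Real.norm_eq_abs] using key
  filter_upwards [Icc_mem_nhds hs.1 hs.2, Metric.ball_mem_nhds s hδ] with r hr hr'
  have m := mvt_lin (φ := fun y => φ r y - φ s y) (φ' := fun y => φx r y - φx s y)
    (convex_ball x δ) (D := (r - s) * ψ s x) (ε := ε * |r - s|)
    (fun y _ => (hx r hr y).sub (hx s hs' y)) (fun y hy => ?_)
    (x := x) (y := x') (Metric.mem_ball_self hδ) hx'
  · simp only [Real.norm_eq_abs]
    calc _ = _ := by congr 1; ring
      _ ≤ _ := m
      _ = _ := by ring
  · exact mvt_lin (φ := fun r' => φx r' y) (φ' := fun r' => ψ r' y)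
      ((convex_Icc a b).inter (convex_ball s δ)) (D := ψ s x) (ε := ε)
      (fun r' hr' => hxt r' hr'.1 y) (fun r' hr' => (H r' hr' _ hy).le)
      (x := s) (y := r) ⟨hs', Metric.mem_ball_self hδ⟩ ⟨hr, hr'⟩

/-- Global characteristics for bounded Lipschitz velocity. -/
lemma exists_char {v : ℝ → ℝ → ℝ} {a b x L K : ℝ} (hab : a ≤ b) (hL : 0 ≤ L) (hK : 0 ≤ K)
    (hlip : ∀ t ∈ Set.Icc a b, ∀ y z, |v t y - v t z| ≤ K * |y - z|)
    (hcont : ∀ y, ContinuousOn (fun t => v t y) (Set.Icc a b))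
    (hbd : ∀ t ∈ Set.Icc a b, ∀ y, |v t y| ≤ L) :
    ∃ q : ℝ → ℝ, q b = x ∧
      ∀ t ∈ Set.Icc a b, HasDerivWithinAt q (v t (q t)) (Set.Icc a b) t := by
  have hA : 0 ≤ L * (b - a) := mul_nonneg hL (by linarith)
  have hPL : IsPicardLindelof v (⟨b, hab, le_rfl⟩ : Set.Icc a b) x
      ⟨L * (b - a), hA⟩ 0 ⟨L, hL⟩ ⟨K, hK⟩ := by
    refine ⟨fun t ht => ?_, fun y _ => hcont y, fun t ht y _ => hbd t ht y, ?_⟩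
    · refine LipschitzOnWith.of_dist_le_mul fun y _ z _ => ?_
      rw [Real.dist_eq, Real.dist_eq]; exact hlip t ht y z
    · change L * max (b - b) (b - a) ≤ L * (b - a) - 0
      rw [sub_self, max_eq_right (by linarith)]; linarith
  exact hPL.exists_eq_forall_mem_Icc_hasDerivWithinAt₀

/-! ### Facts about classical solutions -/

lemma timeDomain_mono {T : ℝ≥0∞} {s t : ℝ} (hs : 0 ≤ s) (hst : s ≤ t) (ht : t ∈ timeDomain T) :
    s ∈ timeDomain T :=
  ⟨hs, lt_of_le_of_lt (ENNReal.ofReal_le_ofReal hst) ht.2⟩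

noncomputable def C1 (n : ℕ) : ℝ := (n : ℝ) / 2 + (n : ℝ) * ((n : ℝ) + 3) / (2 * ((n : ℝ) + 1))

lemma C1_nonneg (n : ℕ) : 0 ≤ C1 n := by unfold C1; positivity

lemma pow_aux {n : ℕ} (hn : 0 < n) (a b : ℝ) :
    |a ^ (n - 1) * b ^ 2| ≤ (|a| + |b|) ^ (n + 1) ∧ |a ^ n * b| ≤ (|a| + |b|) ^ (n + 1) ∧
    |a ^ (n + 1)| ≤ (|a| + |b|) ^ (n + 1) := by
  obtain ⟨m, rfl⟩ : ∃ m, n = m + 1 := ⟨n - 1, by omega⟩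
  have ha := abs_nonneg a
  have hb := abs_nonneg b
  refine ⟨?_, ?_, ?_⟩
  · rw [abs_mul, abs_pow, abs_pow, Nat.add_sub_cancel,
      show (|a| + |b|) ^ (m + 1 + 1) = (|a| + |b|) ^ m * (|a| + |b|) ^ 2 by ring]
    gcongr <;> linarith
  · rw [abs_mul, abs_pow, pow_succ (|a| + |b|)]
    gcongr <;> linarith
  · rw [abs_pow]
    gcongr; linarith

lemma fLoc_nonneg {n : ℕ} (hodd : Odd n) (u : ℝ → ℝ → ℝ) (t x : ℝ) : 0 ≤ fLoc n u t x := by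
  obtain ⟨m, rfl⟩ := hodd
  have h1 : 0 ≤ u t x ^ (2 * m + 1 - 1) := Even.pow_nonneg (by simp) _
  have h2 : 0 ≤ u t x ^ (2 * m + 1 + 1) := Even.pow_nonneg ⟨m + 1, by ring⟩ _
  unfold fLoc
  positivity

lemma fLoc_ge {n : ℕ} (hodd : Odd n) (u : ℝ → ℝ → ℝ) (t x : ℝ) :
    ((n : ℝ) * ((n : ℝ) + 3) / (2 * ((n : ℝ) + 1))) * |u t x| ^ (n + 1) ≤ fLoc n u t x := by
  obtain ⟨m, rfl⟩ := hodd
  have h1 : 0 ≤ u t x ^ (2 * m + 1 - 1) := Even.pow_nonneg (by simp) _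
  have h2 : |u t x| ^ (2 * m + 1 + 1) = u t x ^ (2 * m + 1 + 1) :=
    Even.pow_abs ⟨m + 1, by ring⟩ _
  rw [h2]
  unfold fLoc
  have : 0 ≤ (((2 * m + 1 : ℕ) : ℝ) / 2) * u t x ^ (2 * m + 1 - 1) * ux u t x ^ 2 := by positivity
  linarith

lemma fLoc_le {n : ℕ} (hn : 0 < n) (u : ℝ → ℝ → ℝ) (t x : ℝ) :
    fLoc n u t x ≤ C1 n * (|u t x| + |ux u t x|) ^ (n + 1) := by
  obtain ⟨h1, -, h3⟩ := pow_aux hn (u t x) (ux u t x)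
  have h1' := (le_abs_self _).trans h1
  have h3' := (le_abs_self _).trans h3
  have c1 : 0 ≤ (n : ℝ) / 2 := by positivity
  have c2 : 0 ≤ (n : ℝ) * ((n : ℝ) + 3) / (2 * ((n : ℝ) + 1)) := by positivity
  unfold fLoc C1
  have a1 := mul_le_mul_of_nonneg_left h1' c1
  have a2 := mul_le_mul_of_nonneg_left h3' c2
  linarith

section sol
variable {n : ℕ} {T : ℝ≥0∞} {u : ℝ → ℝ → ℝ}

lemma sol_hasDerivAt_u (hu : IsClassicalSolution n T u) {t : ℝ} (ht : t ∈ timeDomain T) (x : ℝ) :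
    HasDerivAt (u t) (ux u t x) x :=
  (((hu.contDiff_x t ht).differentiable (by norm_num)) x).hasDerivAt

lemma sol_hasDerivAt_ux (hu : IsClassicalSolution n T u) {t : ℝ} (ht : t ∈ timeDomain T) (x : ℝ) :
    HasDerivAt (ux u t) (uxx u t x) x := by
  have h : ContDiff ℝ 2 (deriv (u t)) := by
    have := hu.contDiff_x t ht
    rw [show (3 : WithTop ℕ∞) = 2 + 1 by norm_num, contDiff_succ_iff_deriv] at this
    exact this.2.2
  exact ((h.differentiable (by norm_num)) x).hasDerivAt

lemma sol_fLoc_cont (hu : IsClassicalSolution n T u) {t : ℝ} (ht : t ∈ timeDomain T) :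
    Continuous (fLoc n u t) := by
  have h1 : Continuous (u t) := continuous_iff_continuousAt.2 fun x =>
    (sol_hasDerivAt_u hu ht x).continuousAt
  have h2 : Continuous (ux u t) := continuous_iff_continuousAt.2 fun x =>
    (sol_hasDerivAt_ux hu ht x).continuousAt
  unfold fLoc
  fun_prop

lemma sol_fLoc_int (hn : 0 < n) (hu : IsClassicalSolution n T u) {t : ℝ} (ht : t ∈ timeDomain T) :
    Integrable (fLoc n u t) := by
  have h1 : Continuous (u t) := continuous_iff_continuousAt.2 fun x =>
    (sol_hasDerivAt_u hu ht x).continuousAt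
  obtain ⟨⟨C, hC⟩, -, i2, -⟩ := hu.decay_u t ht
  obtain ⟨-, -, j2, -⟩ := hu.decay_ux t ht
  have hb : ∀ᵐ x, ‖u t x ^ (n - 1)‖ ≤ C ^ (n - 1) := Eventually.of_forall fun x => by
    rw [norm_pow]; exact pow_le_pow_left₀ (norm_nonneg _) (hC x) _
  have hm : AEStronglyMeasurable (fun x => u t x ^ (n - 1)) :=
    (h1.pow _).aestronglyMeasurable
  have a := (j2.bdd_mul hm hb).const_mul ((n : ℝ) / 2)
  have b := (i2.bdd_mul hm hb).const_mul ((n : ℝ) * ((n : ℝ) + 3) / (2 * ((n : ℝ) + 1)))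
  refine (a.add b).congr (Eventually.of_forall fun x => ?_)
  obtain ⟨m, rfl⟩ : ∃ m, n = m + 1 := ⟨n - 1, by omega⟩
  simp only [fLoc, Pi.add_apply, Nat.add_sub_cancel]
  ring

lemma sol_FLoc (hn : 0 < n) (hu : IsClassicalSolution n T u) {t : ℝ} (ht : t ∈ timeDomain T)
    (x : ℝ) : FLoc n u t x = FF (fLoc n u t) x := by
  have hi := sol_fLoc_int hn hu ht
  unfold FLoc
  rw [show (fun z => ∫ y : ℝ, g (z - y) * fLoc n u t y) = GG (fLoc n u t) from
    funext fun z => green_eq hi z]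
  exact (hasDerivAt_GG (sol_fLoc_cont hu ht) hi x).deriv

lemma sol_ut (hn : 0 < n) (hu : IsClassicalSolution n T u) {t : ℝ} (ht : t ∈ timeDomain T)
    (x : ℝ) : ut u t x = -(u t x ^ n * ux u t x) - FF (fLoc n u t) x := by
  have := hu.nonlocal t ht x
  rw [sol_FLoc hn hu ht] at this
  linarith

lemma sol_cont_sub {a b : ℝ} (ha : 0 ≤ a) (hb : b ∈ timeDomain T) :
    (Set.Icc a b ×ˢ (Set.univ : Set ℝ)) ⊆ timeDomain T ×ˢ Set.univ :=
  Set.prod_mono (fun _ hs => timeDomain_mono (ha.trans hs.1) hs.2 hb) le_rfl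

lemma sol_utx (hn : 0 < n) (hu : IsClassicalSolution n T u) {a b s : ℝ} (ha : 0 ≤ a)
    (hb : b ∈ timeDomain T) (hs : s ∈ Set.Ioo a b) (x : ℝ) :
    utx u s x = -(n * (u s x ^ (n - 1) * ux u s x ^ 2)) - u s x ^ n * uxx u s x
      - GG (fLoc n u s) x + fLoc n u s x := by
  have hd : ∀ r ∈ Set.Icc a b, r ∈ timeDomain T := fun r hr =>
    timeDomain_mono (ha.trans hr.1) hr.2 hb
  have hst := hd s (Set.Ioo_subset_Icc_self hs)
  have h1 : HasDerivAt (ut u s) (utx u s x) x :=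
    hasDerivAt_symm (φ := u) (φx := ux u) (φt := ut u) (ψ := utx u) hs
      (fun r hr y => sol_hasDerivAt_u hu (hd r hr) y)
      (fun r hr y => (hu.diff_t y r (hd r hr)).hasDerivAt)
      (fun r hr y => (hu.diff_tx y r (hd r hr)).hasDerivAt)
      (hu.cont_utx.mono (sol_cont_sub ha hb))
  have h2 := ((((sol_hasDerivAt_u hu hst x).pow n).mul (sol_hasDerivAt_ux hu hst x)).neg).sub
    (hasDerivAt_FF (sol_fLoc_cont hu hst) (sol_fLoc_int hn hu hst) x)
  rw [show ut u s = _ from funext fun y => sol_ut hn hu hst y] at h1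
  have := h1.unique h2
  rw [this]; simp only [Pi.pow_apply]; ring

end sol

lemma compare {a b K : ℝ} (hab : a ≤ b) {y y' W W' : ℝ → ℝ}
    (hy : ContinuousOn y (Set.Icc a b)) (hW : ContinuousOn W (Set.Icc a b))
    (hy' : ∀ s ∈ Set.Ioo a b, HasDerivAt y (y' s) s)
    (hW' : ∀ s ∈ Set.Ioo a b, HasDerivAt W (W' s) s)
    (h : ∀ s ∈ Set.Ioo a b, |y' s| ≤ K * W' s) (h0 : |y a| ≤ K * W a) : |y b| ≤ K * W b := by
  have m1 : MonotoneOn (fun s => K * W s + y s) (Set.Icc a b) := by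
    refine monotoneOn_of_deriv_nonneg (convex_Icc a b) ((hW.const_mul K).add hy) ?_ ?_ <;>
      rw [interior_Icc] <;> intro s hs
    · exact (((hW' s hs).const_mul K).add (hy' s hs)).differentiableAt.differentiableWithinAt
    · have e := (((hW' s hs).const_mul K).add (hy' s hs)).deriv
      have := neg_abs_le (y' s)
      have := h s hs
      refine le_of_le_of_eq ?_ e.symm
      linarith
  have m2 : MonotoneOn (fun s => K * W s - y s) (Set.Icc a b) := by
    refine monotoneOn_of_deriv_nonneg (convex_Icc a b) ((hW.const_mul K).sub hy) ?_ ?_ <;>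
      rw [interior_Icc] <;> intro s hs
    · exact (((hW' s hs).const_mul K).sub (hy' s hs)).differentiableAt.differentiableWithinAt
    · have e := (((hW' s hs).const_mul K).sub (hy' s hs)).deriv
      have := le_abs_self (y' s)
      have := h s hs
      refine le_of_le_of_eq ?_ e.symm
      linarith
  have l1 := m1 (Set.left_mem_Icc.2 hab) (Set.right_mem_Icc.2 hab) hab
  have l2 := m2 (Set.left_mem_Icc.2 hab) (Set.right_mem_Icc.2 hab) hab
  simp only at l1 l2
  have := neg_abs_le (y a)
  have := le_abs_self (y a)
  rw [abs_le]; constructor <;> linarith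

/-! ### Persistence of weighted bounds -/

noncomputable def C2 (n : ℕ) (α M : ℝ) : ℝ :=
  ((n : ℝ) + C1 n + (1 / (1 - α)) * C1 n) * M ^ n

lemma step_bound {n : ℕ} {T : ℝ≥0∞} {u : ℝ → ℝ → ℝ} (hn : 0 < n) (hodd : Odd n)
    (hu : IsClassicalSolution n T u)
    {α : ℝ} (hα0 : 0 ≤ α) (hα1 : α < 1) {t0 T0 M : ℝ} (ht0 : 0 ≤ t0) (hT0 : T0 ∈ timeDomain T)
    (hM0 : 0 ≤ M) (hM : ∀ t ∈ Set.Icc t0 T0, ∀ x, |u t x| + |ux u t x| ≤ M)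
    {lam A0 A ε : ℝ} (hε : 0 ≤ ε) (hA0 : 0 ≤ A0) (hA : 0 ≤ A)
    (hlam : α * M ^ n + 4 * C2 n α M ≤ lam)
    (hinit : ∀ x, |u t0 x| + |ux u t0 x| ≤
      A0 * (Real.exp (lam * t0) * (Real.exp (-α * x) + ε)))
    (hbd : ∀ t ∈ Set.Icc t0 T0, ∀ x, |u t x| + |ux u t x| ≤
      A * (Real.exp (lam * t) * (Real.exp (-α * x) + ε))) :
    ∀ t ∈ Set.Icc t0 T0, ∀ x, |u t x| + |ux u t x| ≤
      (2 * A0 + A / 2) * (Real.exp (lam * t) * (Real.exp (-α * x) + ε)) := by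
  intro t ht x
  have htT : t ∈ timeDomain T := timeDomain_mono (ht0.trans ht.1) ht.2 hT0
  have hsub : ∀ s ∈ Set.Icc t0 t, s ∈ Set.Icc t0 T0 := fun s hs => ⟨hs.1, hs.2.trans ht.2⟩
  have hd : ∀ s ∈ Set.Icc t0 t, s ∈ timeDomain T := fun s hs =>
    timeDomain_mono (ht0.trans hs.1) hs.2 htT
  have hul : ∀ s ∈ Set.Icc t0 t, ∀ y, |u s y| ≤ M := fun s hs y =>
    (le_add_of_nonneg_right (abs_nonneg _)).trans (hM s (hsub s hs) y)
  have huxl : ∀ s ∈ Set.Icc t0 t, ∀ y, |ux u s y| ≤ M := fun s hs y =>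
    (le_add_of_nonneg_left (abs_nonneg _)).trans (hM s (hsub s hs) y)
  have hMn : 0 ≤ M ^ n := pow_nonneg hM0 n
  have hvb : ∀ s ∈ Set.Icc t0 t, ∀ y, |u s y ^ n| ≤ M ^ n := fun s hs y => by
    rw [abs_pow]; exact pow_le_pow_left₀ (abs_nonneg _) (hul s hs y) n
  -- the characteristic through `(t, x)`
  obtain ⟨q, hqx, hq⟩ := exists_char (v := fun s y => u s y ^ n) (x := x) (L := M ^ n)
    (K := n * M ^ (n - 1) * M) ht.1 hMn (by positivity)
    (fun s hs y z => by
      have := convex_univ.norm_image_sub_le_of_norm_hasDerivWithin_le (f := fun y => u s y ^ n)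
        (f' := fun y => n * u s y ^ (n - 1) * ux u s y) (C := n * M ^ (n - 1) * M)
        (fun r _ => ((sol_hasDerivAt_u hu (hd s hs) r).pow n).hasDerivWithinAt)
        (fun r _ => by
          rw [norm_mul, norm_mul, norm_pow, Real.norm_natCast]
          have := hul s hs r
          have := huxl s hs r
          simp only [Real.norm_eq_abs]
          gcongr) (Set.mem_univ z) (Set.mem_univ y)
      simpa only [Real.norm_eq_abs] using this)
    (fun y s hs => ((hu.diff_t y s (hd s hs)).continuousAt.continuousWithinAt).pow n)
    hvb
  have hqc : ContinuousOn q (Set.Icc t0 t) := fun s hs => (hq s hs).continuousWithinAt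
  have hIoo : ∀ s ∈ Set.Ioo t0 t, Set.Icc t0 t ∈ 𝓝 s := fun s hs => Icc_mem_nhds hs.1 hs.2
  have hII : ∀ s ∈ Set.Ioo t0 t, s ∈ Set.Icc t0 t := fun s hs => Set.Ioo_subset_Icc_self hs
  -- the two unknowns along the characteristic
  have hY1 : ∀ s ∈ Set.Icc t0 t, HasDerivWithinAt (fun r => u r (q r))
      (ut u s (q s) + ux u s (q s) * u s (q s) ^ n) (Set.Icc t0 t) s := fun s hs =>
    hasDerivWithinAt_along (φ := u) (φt := ut u) hs
      (fun r hr y => (hu.diff_t y r (hd r hr)).hasDerivAt)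
      (hu.cont_ut.mono (sol_cont_sub ht0 htT)) (sol_hasDerivAt_u hu (hd s hs) _) (hq s hs)
  have hY2 : ∀ s ∈ Set.Icc t0 t, HasDerivWithinAt (fun r => ux u r (q r))
      (utx u s (q s) + uxx u s (q s) * u s (q s) ^ n) (Set.Icc t0 t) s := fun s hs =>
    hasDerivWithinAt_along (φ := ux u) (φt := utx u) hs
      (fun r hr y => (hu.diff_tx y r (hd r hr)).hasDerivAt)
      (hu.cont_utx.mono (sol_cont_sub ht0 htT)) (sol_hasDerivAt_ux hu (hd s hs) _) (hq s hs)
  -- the weight along the characteristic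
  have hW' : ∀ s ∈ Set.Icc t0 t,
      HasDerivWithinAt (fun r => Real.exp (lam * r) * (Real.exp (-α * q r) + ε))
      (lam * (Real.exp (lam * s) * (Real.exp (-α * q s) + ε))
        - α * u s (q s) ^ n * (Real.exp (lam * s) * Real.exp (-α * q s))) (Set.Icc t0 t) s := by
    intro s hs
    have e1 : HasDerivWithinAt (fun r : ℝ => Real.exp (lam * r)) (Real.exp (lam * s) * (lam * 1))
        (Set.Icc t0 t) s := (((hasDerivAt_id s).const_mul lam).exp).hasDerivWithinAt
    have e2 := (((hq s hs).const_mul (-α)).exp).add_const ε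
    exact (e1.mul e2).congr_deriv (by ring)
  have hC1 := C1_nonneg n
  have ha2 : 0 ≤ 1 / (1 - α) := by
    apply div_nonneg zero_le_one; linarith
  have hC2 : 0 ≤ C2 n α M := by unfold C2; positivity
  have hWlow : ∀ s ∈ Set.Icc t0 t, 4 * C2 n α M * (Real.exp (lam * s) * (Real.exp (-α * q s) + ε))
      ≤ lam * (Real.exp (lam * s) * (Real.exp (-α * q s) + ε))
        - α * u s (q s) ^ n * (Real.exp (lam * s) * Real.exp (-α * q s)) := by
    intro s hs
    have v := (le_abs_self _).trans (hvb s hs (q s))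
    have w1 : 0 ≤ Real.exp (lam * s) * Real.exp (-α * q s) := by positivity
    have w2 : 0 ≤ Real.exp (lam * s) * ε := by positivity
    have k1 : α * u s (q s) ^ n * (Real.exp (lam * s) * Real.exp (-α * q s))
        ≤ α * M ^ n * (Real.exp (lam * s) * (Real.exp (-α * q s) + ε)) := by
      have : α * u s (q s) ^ n ≤ α * M ^ n := mul_le_mul_of_nonneg_left v hα0
      refine mul_le_mul this ?_ w1 (by positivity)
      rw [mul_add]; linarith
    have k2 := mul_le_mul_of_nonneg_right hlam
      (show 0 ≤ Real.exp (lam * s) * (Real.exp (-α * q s) + ε) by positivity)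
    linarith
  -- pointwise estimates of the derivatives
  have hest : ∀ s ∈ Set.Icc t0 t, ∀ y,
      (|u s y| + |ux u s y|) ^ (n + 1) ≤
        M ^ n * A * (Real.exp (lam * s) * (Real.exp (-α * y) + ε)) := by
    intro s hs y
    have h1 := hM s (hsub s hs) y
    have h2 := hbd s (hsub s hs) y
    have h3 : 0 ≤ |u s y| + |ux u s y| := by positivity
    rw [pow_succ, mul_assoc]
    exact mul_le_mul (pow_le_pow_left₀ h3 h1 n) h2 h3 hMn
  have hf : ∀ s ∈ Set.Icc t0 t, ∀ y, fLoc n u s y ≤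
      (C1 n * M ^ n * A * Real.exp (lam * s)) * (Real.exp (-α * y) + ε) := by
    intro s hs y
    refine (fLoc_le hn u s y).trans ?_
    refine (mul_le_mul_of_nonneg_left (hest s hs y) hC1).trans (le_of_eq (by ring))
  have hFG : ∀ s ∈ Set.Icc t0 t, ∀ y, _ := fun s hs y =>
    FG_bound (sol_fLoc_int hn hu (hd s hs)) (fLoc_nonneg hodd u s) hα0 hα1
      (show 0 ≤ C1 n * M ^ n * A * Real.exp (lam * s) by positivity) hε (hf s hs) y
  have hK : A ≤ 4 * (A0 + A / 4) := by linarith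
  have hfin : ∀ s ∈ Set.Icc t0 t,
      C2 n α M * A * (Real.exp (lam * s) * (Real.exp (-α * q s) + ε)) ≤
      (A0 + A / 4) * (lam * (Real.exp (lam * s) * (Real.exp (-α * q s) + ε))
        - α * u s (q s) ^ n * (Real.exp (lam * s) * Real.exp (-α * q s))) := by
    intro s hs
    have h1 := mul_le_mul_of_nonneg_left (hWlow s hs) (show 0 ≤ A0 + A / 4 by positivity)
    refine le_trans ?_ h1
    have : 0 ≤ C2 n α M * (Real.exp (lam * s) * (Real.exp (-α * q s) + ε)) := by positivity
    have := mul_le_mul_of_nonneg_left hK this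
    linarith
  have hWc : ContinuousOn (fun r => Real.exp (lam * r) * (Real.exp (-α * q r) + ε))
      (Set.Icc t0 t) := fun s hs => (hW' s hs).continuousWithinAt
  have hinit' : |u t0 (q t0)| ≤
      (A0 + A / 4) * (Real.exp (lam * t0) * (Real.exp (-α * q t0) + ε)) ∧
      |ux u t0 (q t0)| ≤ (A0 + A / 4) * (Real.exp (lam * t0) * (Real.exp (-α * q t0) + ε)) := by
    have h1 := hinit (q t0)
    have h2 : 0 ≤ (A / 4) * (Real.exp (lam * t0) * (Real.exp (-α * q t0) + ε)) := by positivity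
    have h3 := abs_nonneg (u t0 (q t0))
    have h4 := abs_nonneg (ux u t0 (q t0))
    constructor <;> linarith
  have r1 := compare (K := A0 + A / 4) ht.1 (y := fun r => u r (q r))
    (fun s hs => (hY1 s hs).continuousWithinAt) hWc
    (fun s hs => (hY1 s (hII s hs)).hasDerivAt (hIoo s hs))
    (fun s hs => (hW' s (hII s hs)).hasDerivAt (hIoo s hs))
    (fun s hs => by
      have hs' := hII s hs
      refine le_trans ?_ (hfin s hs')
      rw [sol_ut hn hu (hd s hs')]
      rw [show -(u s (q s) ^ n * ux u s (q s)) - FF (fLoc n u s) (q s) +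
        ux u s (q s) * u s (q s) ^ n = - FF (fLoc n u s) (q s) by ring, abs_neg]
      refine (hFG s hs' (q s)).1.trans ?_
      unfold C2
      have : 0 ≤ ((n : ℝ) + C1 n) * (M ^ n * A *
        (Real.exp (lam * s) * (Real.exp (-α * q s) + ε))) := by positivity
      linarith)
    hinit'.1
  have r2 := compare (K := A0 + A / 4) ht.1 (y := fun r => ux u r (q r))
    (fun s hs => (hY2 s hs).continuousWithinAt) hWc
    (fun s hs => (hY2 s (hII s hs)).hasDerivAt (hIoo s hs))
    (fun s hs => (hW' s (hII s hs)).hasDerivAt (hIoo s hs))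
    (fun s hs => by
      have hs' := hII s hs
      refine le_trans ?_ (hfin s hs')
      rw [sol_utx hn hu ht0 htT hs]
      rw [show -(n * (u s (q s) ^ (n - 1) * ux u s (q s) ^ 2)) - u s (q s) ^ n * uxx u s (q s)
        - GG (fLoc n u s) (q s) + fLoc n u s (q s) + uxx u s (q s) * u s (q s) ^ n
        = -(n * (u s (q s) ^ (n - 1) * ux u s (q s) ^ 2))
        - GG (fLoc n u s) (q s) + fLoc n u s (q s) by ring]
      have b1 := (hFG s hs' (q s)).2
      have b2 := hf s hs' (q s)
      have b3 := fLoc_nonneg hodd u s (q s)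
      have b4 := mul_le_mul_of_nonneg_left
        (((pow_aux hn (u s (q s)) (ux u s (q s))).1).trans (hest s hs' (q s)))
        (Nat.cast_nonneg (α := ℝ) n)
      have b5 : |(n : ℝ) * (u s (q s) ^ (n - 1) * ux u s (q s) ^ 2)| =
        n * |u s (q s) ^ (n - 1) * ux u s (q s) ^ 2| := by rw [abs_mul, Nat.abs_cast]
      rw [← b5] at b4
      rw [abs_le] at b1 b4
      unfold C2
      rw [abs_le]
      obtain ⟨b1, b1'⟩ := b1
      obtain ⟨b4, b4'⟩ := b4
      constructor <;> linarith)
    hinit'.2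
  simp only [hqx] at r1 r2
  linarith

lemma persistence {n : ℕ} {T : ℝ≥0∞} {u : ℝ → ℝ → ℝ} (hn : 0 < n) (hodd : Odd n)
    (hu : IsClassicalSolution n T u)
    {α : ℝ} (hα0 : 0 ≤ α) (hα1 : α < 1) {t0 T0 : ℝ} (ht0 : 0 ≤ t0) (hT0 : T0 ∈ timeDomain T)
    {A0 : ℝ} (hA0 : 0 ≤ A0) (hinit : ∀ x, |u t0 x| + |ux u t0 x| ≤ A0 * Real.exp (-α * x)) :
    ∃ D, 0 ≤ D ∧ ∀ t ∈ Set.Icc t0 T0, ∀ x,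
      |u t x| + |ux u t x| ≤ A0 * D * Real.exp (-α * x) := by
  obtain ⟨M, hM⟩ := hu.sup_bound T0 hT0
  have hM' : ∀ t ∈ Set.Icc t0 T0, ∀ x, |u t x| + |ux u t x| ≤ M := fun t ht x =>
    hM t ⟨ht0.trans ht.1, ht.2⟩ x
  have hM0 : 0 ≤ M := le_trans (by positivity) (hM T0 ⟨hT0.1, le_rfl⟩ 0)
  have ha2 : 0 ≤ 1 / (1 - α) := by
    apply div_nonneg zero_le_one; linarith
  have hC1 := C1_nonneg n
  have hC2 : 0 ≤ C2 n α M := by unfold C2; positivity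
  set lam := α * M ^ n + 4 * C2 n α M with hlam
  have hlam0 : 0 ≤ lam := by positivity
  refine ⟨4 * Real.exp (lam * T0), by positivity, ?_⟩
  -- a bound uniform in `ε`
  have key : ∀ ε > 0, ∀ t ∈ Set.Icc t0 T0, ∀ x, |u t x| + |ux u t x| ≤
      (4 * A0) * (Real.exp (lam * t) * (Real.exp (-α * x) + ε)) := by
    intro ε hε
    have it : ∀ k : ℕ, ∀ t ∈ Set.Icc t0 T0, ∀ x, |u t x| + |ux u t x| ≤
      (4 * A0 + (M / ε) * (1 / 2) ^ k) * (Real.exp (lam * t) * (Real.exp (-α * x) + ε)) := by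
      intro k
      induction k with
      | zero =>
        intro t ht x
        refine (hM' t ht x).trans ?_
        have e1 : 1 ≤ Real.exp (lam * t) :=
          Real.one_le_exp (mul_nonneg hlam0 (ht0.trans ht.1))
        have e2 : ε ≤ Real.exp (lam * t) * (Real.exp (-α * x) + ε) := by
          have := Real.exp_pos (-α * x)
          nlinarith
        calc M = (M / ε) * ε := by field_simp
          _ ≤ (4 * A0 + (M / ε) * (1 / 2) ^ 0) * ε := by
            apply mul_le_mul_of_nonneg_right _ hε.le
            simp; exact hA0
          _ ≤ _ := by
            apply mul_le_mul_of_nonneg_left e2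
            positivity
      | succ k ih =>
        have := step_bound hn hodd hu hα0 hα1 ht0 hT0 hM0 hM' hε.le hA0
          (show 0 ≤ 4 * A0 + (M / ε) * (1 / 2) ^ k by positivity) hlam.symm.le
          (fun x => (hinit x).trans ?_) ih
        · intro t ht x
          refine (this t ht x).trans (le_of_eq ?_)
          rw [pow_succ]; ring
        · have e1 : 1 ≤ Real.exp (lam * t0) := Real.one_le_exp (mul_nonneg hlam0 ht0)
          have := Real.exp_pos (-α * x)
          apply mul_le_mul_of_nonneg_left _ hA0
          nlinarith
    intro t ht x
    have lim : Tendsto (fun k : ℕ => (4 * A0 + (M / ε) * (1 / 2) ^ k) *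
        (Real.exp (lam * t) * (Real.exp (-α * x) + ε))) atTop
        (𝓝 ((4 * A0 + (M / ε) * 0) * (Real.exp (lam * t) * (Real.exp (-α * x) + ε)))) :=
      ((tendsto_const_nhds.add ((tendsto_pow_atTop_nhds_zero_of_lt_one (by norm_num)
        (by norm_num)).const_mul _))).mul_const _
    have := ge_of_tendsto' lim fun k => it k t ht x
    simpa using this
  intro t ht x
  have lim : Tendsto (fun ε : ℝ => (4 * A0) * (Real.exp (lam * t) * (Real.exp (-α * x) + ε)))
      (𝓝[>] 0) (𝓝 ((4 * A0) * (Real.exp (lam * t) * (Real.exp (-α * x) + 0)))) := by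
    apply tendsto_nhdsWithin_of_tendsto_nhds
    exact (by fun_prop : Continuous fun ε : ℝ =>
      (4 * A0) * (Real.exp (lam * t) * (Real.exp (-α * x) + ε))).tendsto 0
  have h1 := ge_of_tendsto lim (eventually_nhdsWithin_of_forall fun ε hε => key ε hε t ht x)
  refine h1.trans ?_
  have : Real.exp (lam * t) ≤ Real.exp (lam * T0) :=
    Real.exp_le_exp.2 (mul_le_mul_of_nonneg_left ht.2 hlam0)
  have e := Real.exp_pos (-α * x)
  calc _ = (4 * A0 * Real.exp (-α * x)) * Real.exp (lam * t) := by ring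
    _ ≤ (4 * A0 * Real.exp (-α * x)) * Real.exp (lam * T0) := by gcongr
    _ = _ := by ring

/-! ### The final argument -/

lemma grow {y y' : ℝ → ℝ} {a b m : ℝ} (hab : a ≤ b)
    (hy : ∀ s ∈ Set.Icc a b, HasDerivAt y (y' s) s) (hm : ∀ s ∈ Set.Icc a b, m ≤ y' s) :
    m * (b - a) ≤ y b - y a := by
  refine (convex_Icc a b).mul_sub_le_image_sub_of_le_deriv
    (fun s hs => (hy s hs).continuousAt.continuousWithinAt)
    (fun s hs => (hy s (interior_subset hs)).differentiableAt.differentiableWithinAt)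
    (fun s hs => ?_) a (Set.left_mem_Icc.2 hab) b (Set.right_mem_Icc.2 hab) hab
  rw [(hy s (interior_subset hs)).deriv]
  exact hm s (interior_subset hs)

lemma PP_ge {h : ℝ → ℝ} (hi : Integrable h) (h0 : ∀ y, 0 ≤ h y) {y0 δ κ x : ℝ} (hδ : 0 ≤ δ)
    (hκ : 0 ≤ κ)
    (hx : y0 + δ ≤ x) (hk : ∀ y ∈ Set.Icc y0 (y0 + δ), κ ≤ h y) :
    δ * (Real.exp y0 * κ) ≤ PP h x := by
  have hsub : Set.Icc y0 (y0 + δ) ⊆ Set.Iic x := fun y hy => hy.2.trans hx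
  have hI := integrableOn_PP hi x
  calc δ * (Real.exp y0 * κ) = ∫ _ in Set.Icc y0 (y0 + δ), Real.exp y0 * κ := by
        rw [setIntegral_const, Measure.real, Real.volume_Icc]
        simp [hδ]
    _ ≤ ∫ y in Set.Icc y0 (y0 + δ), Real.exp y * h y := by
        refine setIntegral_mono_on (integrableOn_const (by simp)) (hI.mono_set hsub) measurableSet_Icc fun y hy => ?_
        exact mul_le_mul (Real.exp_le_exp.2 hy.1) (hk y hy) hκ (Real.exp_pos _).le
    _ ≤ PP h x := setIntegral_mono_set hI
        (Eventually.of_forall fun y => mul_nonneg (Real.exp_pos _).le (h0 y))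
        (LE.le.eventuallyLE hsub)

lemma initial_bound {n : ℕ} {T : ℝ≥0∞} {u : ℝ → ℝ → ℝ}
    (hu : IsClassicalSolution n T u) {α : ℝ} (hα0 : 0 ≤ α) (hα₂ : α < 1)
    (hT : (0 : ℝ) ∈ timeDomain T)
    (h0 : Tendsto (fun x => Real.exp x * |u 0 x|) atTop (𝓝 0))
    (h0' : ∃ C : ℝ, ∀ᶠ x in atTop, Real.exp (α * x) * |ux u 0 x| ≤ C) :
    ∃ A0, 0 ≤ A0 ∧ ∀ x, |u 0 x| + |ux u 0 x| ≤ A0 * Real.exp (-α * x) := by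
  obtain ⟨C, hC⟩ := h0'
  obtain ⟨M, hM⟩ := hu.sup_bound 0 hT
  have hM0 : 0 ≤ M := le_trans (by positivity) (hM 0 ⟨le_rfl, le_rfl⟩ 0)
  have h1 : ∀ᶠ x in atTop, Real.exp x * |u 0 x| < 1 := h0.eventually_lt_const one_pos
  obtain ⟨X, hX⟩ := eventually_atTop.1 ((hC.and h1).and (eventually_ge_atTop 0))
  refine ⟨1 + |C| + Real.exp (α * X) * M, by positivity, fun x => ?_⟩
  have e : Real.exp (α * x) * Real.exp (-α * x) = 1 := by rw [← Real.exp_add]; simp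
  suffices H : Real.exp (α * x) * (|u 0 x| + |ux u 0 x|) ≤ 1 + |C| + Real.exp (α * X) * M by
    have := mul_le_mul_of_nonneg_right H (Real.exp_pos (-α * x)).le
    calc _ = (Real.exp (α * x) * Real.exp (-α * x)) * (|u 0 x| + |ux u 0 x|) := by rw [e, one_mul]
      _ = _ := by ring
      _ ≤ _ := this
  rcases le_total X x with h | h
  · obtain ⟨⟨a, b⟩, c⟩ := hX x h
    have d : Real.exp (α * x) ≤ Real.exp x := Real.exp_le_exp.2 (by nlinarith)
    have d' := mul_le_mul_of_nonneg_right d (abs_nonneg (u 0 x))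
    have := le_abs_self C
    have : 0 ≤ Real.exp (α * X) * M := by positivity
    rw [mul_add]; linarith
  · have d : Real.exp (α * x) ≤ Real.exp (α * X) :=
      Real.exp_le_exp.2 (mul_le_mul_of_nonneg_left h hα0)
    have := mul_le_mul d (hM 0 ⟨le_rfl, le_rfl⟩ x) (by positivity) (Real.exp_pos _).le
    have := abs_nonneg C
    linarith

lemma vanish_early {n : ℕ} {T : ℝ≥0∞} {u : ℝ → ℝ → ℝ} (hn : 0 < n) (hodd : Odd n)
    (hu : IsClassicalSolution n T u)
    {α : ℝ} (hα₁ : 1 / ((n : ℝ) + 1) < α) (hα₂ : α < 1)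
    (h0 : Tendsto (fun x => Real.exp x * |u 0 x|) atTop (𝓝 0))
    (h0' : ∃ C : ℝ, ∀ᶠ x in atTop, Real.exp (α * x) * |ux u 0 x| ≤ C)
    {t₁ : ℝ} (ht₁ : 0 < t₁) (ht₁T : t₁ ∈ timeDomain T)
    (h1 : Tendsto (fun x => Real.exp x * |u t₁ x|) atTop (𝓝 0)) :
    ∀ t ∈ Set.Icc 0 t₁, ∀ x : ℝ, u t x = 0 := by
  have hα0 : 0 ≤ α := le_trans (by positivity) hα₁.le
  have h0T : (0 : ℝ) ∈ timeDomain T := timeDomain_mono le_rfl ht₁.le ht₁T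
  have hd : ∀ r ∈ Set.Icc 0 t₁, r ∈ timeDomain T := fun r hr =>
    timeDomain_mono hr.1 hr.2 ht₁T
  obtain ⟨A0, hA0, hinit⟩ := initial_bound hu hα0 hα₂ h0T h0 h0'
  obtain ⟨D, hD, hpers⟩ := persistence hn hodd hu hα0 hα₂ le_rfl ht₁T hA0 hinit
  obtain ⟨M, hM⟩ := hu.sup_bound t₁ ht₁T
  have hM0 : 0 ≤ M := le_trans (by positivity) (hM t₁ ⟨ht₁.le, le_rfl⟩ 0)
  set K := A0 * D with hK
  have hK0 : 0 ≤ K := mul_nonneg hA0 hD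
  set β := ((n : ℝ) + 1) * α with hβ
  have hβ1 : 1 < β := by
    rw [div_lt_iff₀ (by positivity)] at hα₁
    linarith
  have hC1 := C1_nonneg n
  have hN : ∀ t ∈ Set.Icc 0 t₁, ∀ x, (|u t x| + |ux u t x|) ^ (n + 1) ≤
      K ^ (n + 1) * Real.exp (-β * x) := by
    intro t ht x
    refine (pow_le_pow_left₀ (by positivity) (hpers t ht x) (n + 1)).trans (le_of_eq ?_)
    rw [mul_pow, ← Real.exp_nat_mul]
    congr 2; rw [hβ]; push_cast; ring
  set R := K ^ (n + 1) + C1 n * K ^ (n + 1) with hR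
  have hR0 : 0 ≤ R := by positivity
  -- lower bound for `u_t`
  have hlow : ∀ t ∈ Set.Icc 0 t₁, ∀ x,
      Real.exp (-x) / 2 * PP (fLoc n u t) x - R * Real.exp (-β * x) ≤ ut u t x := by
    intro t ht x
    rw [sol_ut hn hu (hd t ht)]
    have b1 := (le_abs_self _).trans (((pow_aux hn (u t x) (ux u t x)).2.1).trans (hN t ht x))
    have b2 := QQ_le (sol_fLoc_int hn hu (hd t ht)) (B := C1 n * K ^ (n + 1)) (b := β)
      (by linarith) (by positivity) (fun y => (fLoc_le hn u t y).trans
        ((mul_le_mul_of_nonneg_left (hN t ht y) hC1).trans (le_of_eq (by ring)))) x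
    have b3 := mul_le_mul_of_nonneg_left b2 (Real.exp_pos x).le
    have e : Real.exp x * Real.exp (-x) = 1 := by rw [← Real.exp_add]; simp
    have b4 : Real.exp x * (C1 n * K ^ (n + 1) * (Real.exp (-x) * Real.exp (-β * x))) =
      C1 n * K ^ (n + 1) * Real.exp (-β * x) := by
      linear_combination (C1 n * K ^ (n + 1) * Real.exp (-β * x)) * e
    rw [b4] at b3
    have b5 : 0 ≤ C1 n * K ^ (n + 1) * Real.exp (-β * x) := by positivity
    unfold FF
    rw [hR]
    linarith
  by_contra hcon
  push Not at hcon
  obtain ⟨s, hs, y0, hne⟩ := hcon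
  set η := |u s y0| with hη
  have hη0 : 0 < η := abs_pos.2 hne
  have hcs : ContinuousAt (fun t => u t y0) s := (hu.diff_t y0 s (hd s hs)).continuousAt
  obtain ⟨r, hr, hrs⟩ := Metric.continuousAt_iff.1 hcs (η / 4) (by positivity)
  set a := max 0 (s - r / 2) with ha
  set b := min t₁ (s + r / 2) with hb
  have hab : a < b := by
    rw [ha, hb]
    refine max_lt (lt_min ht₁ (by linarith [hs.1])) (lt_min (by linarith [hs.2]) (by linarith))
  have ha0 : 0 ≤ a := le_max_left _ _
  have hbt : b ≤ t₁ := min_le_left _ _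
  have has : s - r / 2 ≤ a := le_max_right _ _
  have hbs : b ≤ s + r / 2 := min_le_right _ _
  set δ := η / (4 * (M + 1)) with hδ
  have hδ0 : 0 < δ := by positivity
  have hMδ : M * δ ≤ η / 4 := by
    rw [hδ, mul_div_assoc', div_le_div_iff₀ (by positivity) (by norm_num)]
    nlinarith
  set c := (n : ℝ) * ((n : ℝ) + 3) / (2 * ((n : ℝ) + 1)) with hc
  have hn' : (0 : ℝ) < n := by exact_mod_cast hn
  have hc0 : 0 < c := by positivity
  set κ := c * (η / 2) ^ (n + 1) with hκ
  have hκ0 : 0 < κ := by positivity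
  have hfl : ∀ t ∈ Set.Icc a b, ∀ y ∈ Set.Icc y0 (y0 + δ), κ ≤ fLoc n u t y := by
    intro t ht y hy
    have ht' : t ∈ Set.Icc 0 t₁ := ⟨ha0.trans ht.1, ht.2.trans hbt⟩
    have i1 : |u t y0 - u s y0| < η / 4 := by
      have : dist t s < r := by
        rw [Real.dist_eq, abs_lt]; constructor <;> linarith [ht.1, ht.2]
      exact hrs this
    have i2 : |u t y - u t y0| ≤ M * |y - y0| := by
      have := convex_univ.norm_image_sub_le_of_norm_hasDerivWithin_le (f := u t)
        (f' := ux u t) (C := M)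
        (fun r _ => (sol_hasDerivAt_u hu (hd t ht') r).hasDerivWithinAt)
        (fun r _ => (le_add_of_nonneg_left (abs_nonneg _)).trans (hM t ht' r))
        (Set.mem_univ y0) (Set.mem_univ y)
      simpa only [Real.norm_eq_abs] using this
    have i3 : M * |y - y0| ≤ M * δ := by
      apply mul_le_mul_of_nonneg_left _ hM0
      rw [abs_le]; constructor <;> linarith [hy.1, hy.2]
    have i4 : η / 2 ≤ |u t y| := by
      have j1 := abs_sub_abs_le_abs_sub (u s y0) (u t y0)
      have j2 := abs_sub_abs_le_abs_sub (u t y0) (u t y)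
      rw [abs_sub_comm] at j1 j2
      linarith
    refine le_trans ?_ (fLoc_ge hodd u t y)
    exact mul_le_mul_of_nonneg_left (pow_le_pow_left₀ (by positivity) i4 _) hc0.le
  set c' := δ * (Real.exp y0 * κ) with hc'
  have hc'0 : 0 < c' := by positivity
  -- the growth inequality for large `x`
  have hgrow : ∀ x, y0 + δ ≤ x →
      c' / 2 * (b - a) ≤ Real.exp x * |u t₁ x| + Real.exp x * |u 0 x|
        + R * t₁ * Real.exp (-((β - 1) * x)) := by
    intro x hx
    have hder : ∀ t ∈ Set.Icc 0 t₁, HasDerivAt (fun t => u t x) (ut u t x) t := fun t ht =>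
      (hu.diff_t x t (hd t ht)).hasDerivAt
    have s1 : ∀ t ∈ Set.Icc 0 a, t ∈ Set.Icc 0 t₁ := fun t ht =>
      ⟨ht.1, ht.2.trans (hab.le.trans hbt)⟩
    have s2 : ∀ t ∈ Set.Icc a b, t ∈ Set.Icc 0 t₁ := fun t ht =>
      ⟨ha0.trans ht.1, ht.2.trans hbt⟩
    have s3 : ∀ t ∈ Set.Icc b t₁, t ∈ Set.Icc 0 t₁ := fun t ht =>
      ⟨ha0.trans (hab.le.trans ht.1), ht.2⟩
    have hlow' : ∀ t ∈ Set.Icc 0 t₁, -(R * Real.exp (-β * x)) ≤ ut u t x := fun t ht => by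
      have := hlow t ht x
      have := mul_nonneg (by positivity : 0 ≤ Real.exp (-x) / 2)
        (PP_nonneg (fLoc_nonneg hodd u t) x)
      linarith
    have g1 := grow ha0 (fun t ht => hder t (s1 t ht)) (fun t ht => hlow' t (s1 t ht))
    have g3 := grow hbt (fun t ht => hder t (s3 t ht)) (fun t ht => hlow' t (s3 t ht))
    have g2 := grow (m := Real.exp (-x) / 2 * c' - R * Real.exp (-β * x)) hab.le
      (fun t ht => hder t (s2 t ht)) (fun t ht => by
        refine le_trans ?_ (hlow t (s2 t ht) x)
        have := PP_ge (sol_fLoc_int hn hu (hd t (s2 t ht))) (fLoc_nonneg hodd u t) hδ0.le hκ0.le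
          hx (hfl t ht)
        have := mul_le_mul_of_nonneg_left this (by positivity : 0 ≤ Real.exp (-x) / 2)
        linarith)
    have g : Real.exp (-x) * (c' / 2 * (b - a)) ≤ |u t₁ x| + |u 0 x|
        + R * t₁ * Real.exp (-β * x) := by
      have := le_abs_self (u t₁ x)
      have := neg_abs_le (u 0 x)
      linarith
    have g' := mul_le_mul_of_nonneg_left g (Real.exp_pos x).le
    have e : Real.exp x * Real.exp (-x) = 1 := by rw [← Real.exp_add]; simp
    have e' : Real.exp x * Real.exp (-β * x) = Real.exp (-((β - 1) * x)) := by
      rw [← Real.exp_add]; ring_nf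
    calc c' / 2 * (b - a) = (Real.exp x * Real.exp (-x)) * (c' / 2 * (b - a)) := by
          rw [e, one_mul]
      _ ≤ Real.exp x * (|u t₁ x| + |u 0 x| + R * t₁ * Real.exp (-β * x)) := by
          rw [mul_assoc]; exact g'
      _ = _ := by rw [← e']; ring
  have hlim3 : Tendsto (fun x : ℝ => Real.exp (-((β - 1) * x))) atTop (𝓝 0) :=
    Real.tendsto_exp_neg_atTop_nhds_zero.comp
      (tendsto_id.const_mul_atTop (by linarith : (0 : ℝ) < β - 1))
  have hlim := (h1.add h0).add (hlim3.const_mul (R * t₁))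
  have := ge_of_tendsto hlim ((eventually_ge_atTop (y0 + δ)).mono hgrow)
  have : 0 < c' / 2 * (b - a) := mul_pos (by positivity) (by linarith)
  linarith

/-- If `n` is odd, the initial datum decays like `o(e^{-x})`
(with `u_x(0,·) = O(e^{-αx})` for some `α ∈ (1/(n+1), 1)`), and at some later time `t₁`
the solution still decays like `o(e^{-x})`, then the solution vanishes identically. -/
theorem decay_persistence_implies_trivial
    (n : ℕ) (hn : 0 < n) (hodd : Odd n) (T : ℝ≥0∞) (hT : 0 < T) (u : ℝ → ℝ → ℝ)
    (hu : IsClassicalSolution n T u)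
    (α : ℝ) (hα₁ : 1 / ((n : ℝ) + 1) < α) (hα₂ : α < 1)
    (h0 : Tendsto (fun x => Real.exp x * |u 0 x|) atTop (𝓝 0))
    (h0' : ∃ C : ℝ, ∀ᶠ x in atTop, Real.exp (α * x) * |ux u 0 x| ≤ C)
    (t₁ : ℝ) (ht₁ : 0 < t₁) (ht₁T : ENNReal.ofReal t₁ < T)
    (h1 : Tendsto (fun x => Real.exp x * |u t₁ x|) atTop (𝓝 0)) :
    ∀ t ∈ timeDomain T, ∀ x : ℝ, u t x = 0 := by
  have ht₁' : t₁ ∈ timeDomain T := ⟨ht₁.le, ht₁T⟩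
  have hearly := vanish_early hn hodd hu hα₁ hα₂ h0 h0' ht₁ ht₁' h1
  intro t ht x
  rcases le_total t t₁ with h | h
  · exact hearly t ⟨ht.1, h⟩ x
  · have hα0 : 0 ≤ α := le_trans (by positivity) hα₁.le
    have hz : u t₁ = fun _ => 0 := funext fun y => hearly t₁ ⟨ht₁.le, le_rfl⟩ y
    obtain ⟨D, -, hD⟩ := persistence hn hodd hu hα0 hα₂ ht₁.le ht (A0 := 0) le_rfl
      (fun y => by simp [ux, hz])
    have h2 := hD t ⟨h, le_rfl⟩ x
    rw [zero_mul, zero_mul] at h2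
    have h3 := abs_nonneg (ux u t x)
    have h4 : |u t x| ≤ 0 := by linarith
    exact abs_nonpos_iff.1 h4
end

section
/- Let n be a positive integer and let u be a classical solution of (CH_n) on [0,T). Then the energy H(t) := (1/2)∫_ℝ (u(t,x)² + u_x(t,x)²) dx is constant on [0,T); that is, ∫_ℝ (u(t,x)² + u_x(t,x)²) dx = ∫_ℝ (u(0,x)² + u_x(0,x)²) dx for all t ∈ [0,T). -/
open Real MeasureTheory Filter Topology
open scoped ENNReal

lemma aux_integrable_g : Integrable (fun y => g y) := by
  have h1 : IntegrableOn (fun y => g y) (Set.Iic 0) := by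
    have : IntegrableOn (fun y => rexp y / 2) (Set.Iic 0) := (integrableOn_exp_Iic 0).div_const 2
    refine this.congr_fun ?_ measurableSet_Iic
    intro y hy
    have hy : y ≤ 0 := hy
    simp [g, abs_of_nonpos hy]
  have h2 : IntegrableOn (fun y => g y) (Set.Ioi 0) := by
    have : IntegrableOn (fun y => rexp (-y) / 2) (Set.Ioi 0) :=
      (integrableOn_exp_neg_Ioi 0).div_const 2
    refine this.congr_fun ?_ measurableSet_Ioi
    intro y hy
    have hy : 0 < y := hy
    simp [g, abs_of_pos hy]
  have := h1.union h2
  rwa [Set.Iic_union_Ioi, integrableOn_univ] at this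

lemma aux_integrable_gconv (f : ℝ → ℝ) (hf : Continuous f) (C : ℝ) (hC : ∀ y, |f y| ≤ C) (x : ℝ) :
    Integrable (fun y => g (x - y) * f y) := by
  have h := aux_integrable_g.comp_sub_left x
  exact h.mul_bdd hf.aestronglyMeasurable (ae_of_all _ fun y => by simpa using hC y)

lemma aux_conv_bound (f : ℝ → ℝ) (C : ℝ) (hC : ∀ y, |f y| ≤ C) (x : ℝ) :
    |∫ y, g (x - y) * f y| ≤ (∫ y, g y) * C := by
  have h := aux_integrable_g.comp_sub_left x
  calc |∫ y, g (x - y) * f y| ≤ ∫ y, g (x - y) * C := by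
        rw [← Real.norm_eq_abs]
        refine norm_integral_le_of_norm_le (h.mul_const C) (ae_of_all _ fun y => ?_)
        rw [norm_mul]
        have hg : 0 ≤ g (x - y) := by unfold g; positivity
        rw [Real.norm_of_nonneg hg]
        exact mul_le_mul_of_nonneg_left (hC y) hg
    _ = _ := by
        rw [integral_mul_const]
        congr 1
        exact integral_sub_left_eq_self (fun y => g y) volume x

lemma aux_hasDerivAt_Iic (h : ℝ → ℝ) (hc : Continuous h) (hi : ∀ x, IntegrableOn h (Set.Iic x))
    (x : ℝ) : HasDerivAt (fun z => ∫ y in Set.Iic z, h y) (h x) x := by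
  have e : (fun z => ∫ y in Set.Iic z, h y)
      = fun z => (∫ y in (0:ℝ)..z, h y) + ∫ y in Set.Iic (0:ℝ), h y := by
    funext z
    have := intervalIntegral.integral_Iic_sub_Iic (hi 0) (hi z)
    linarith
  rw [e]
  exact (hc.integral_hasStrictDerivAt 0 x).hasDerivAt.add_const _

lemma aux_hasDerivAt_Ioi (h : ℝ → ℝ) (hc : Continuous h) (hi : ∀ x, IntegrableOn h (Set.Ioi x))
    (x : ℝ) : HasDerivAt (fun z => ∫ y in Set.Ioi z, h y) (-h x) x := by
  have e : (fun z => ∫ y in Set.Ioi z, h y)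
      = fun z => (∫ y in Set.Ioi (0:ℝ), h y) - (∫ y in (0:ℝ)..z, h y) := by
    funext z
    have := intervalIntegral.integral_interval_add_Ioi (hi 0) (hi z)
    linarith
  rw [e]
  exact (hc.integral_hasStrictDerivAt 0 x).hasDerivAt.const_sub _

lemma aux_conv (f : ℝ → ℝ) (hf : Continuous f) (C : ℝ) (hC : ∀ y, |f y| ≤ C) (x : ℝ) :
    HasDerivAt (fun z => ∫ y, g (z - y) * f y) (deriv (fun z => ∫ y, g (z - y) * f y) x) x ∧
    HasDerivAt (deriv (fun z => ∫ y, g (z - y) * f y)) ((∫ y, g (x - y) * f y) - f x) x := by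
  have hiA : ∀ x, IntegrableOn (fun y => rexp y * f y) (Set.Iic x) := fun x =>
    (integrableOn_exp_Iic x).mul_bdd hf.aestronglyMeasurable
      (ae_of_all _ fun y => by simpa using hC y)
  have hiB : ∀ x, IntegrableOn (fun y => rexp (-y) * f y) (Set.Ioi x) := fun x =>
    (integrableOn_exp_neg_Ioi x).mul_bdd hf.aestronglyMeasurable
      (ae_of_all _ fun y => by simpa using hC y)
  have dA := aux_hasDerivAt_Iic _ (by fun_prop) hiA
  have dB := aux_hasDerivAt_Ioi _ (by fun_prop) hiB
  set A := fun z => ∫ y in Set.Iic z, rexp y * f y with hA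
  set B := fun z => ∫ y in Set.Ioi z, rexp (-y) * f y with hB
  have e : (fun z => ∫ y, g (z - y) * f y) = fun z => (rexp (-z) * A z + rexp z * B z) / 2 := by
    funext z
    have hI := aux_integrable_gconv f hf C hC z
    rw [← intervalIntegral.integral_Iic_add_Ioi (b := z) hI.integrableOn hI.integrableOn]
    have e1 : ∫ y in Set.Iic z, g (z - y) * f y
        = ∫ y in Set.Iic z, (rexp (-z) / 2) * (rexp y * f y) := by
      refine setIntegral_congr_fun measurableSet_Iic fun y hy => ?_
      have hy : y ≤ z := hy
      have : rexp (-(z - y)) = rexp (-z) * rexp y := by rw [← Real.exp_add]; ring_nf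
      simp only [g, abs_of_nonneg (sub_nonneg.2 hy), this]; ring
    have e2 : ∫ y in Set.Ioi z, g (z - y) * f y
        = ∫ y in Set.Ioi z, (rexp z / 2) * (rexp (-y) * f y) := by
      refine setIntegral_congr_fun measurableSet_Ioi fun y hy => ?_
      have hy : z < y := hy
      have : rexp (-(-(z - y))) = rexp z * rexp (-y) := by rw [← Real.exp_add]; ring_nf
      simp only [g, abs_of_neg (sub_neg.2 hy), this]; ring
    rw [e1, e2, integral_const_mul, integral_const_mul]
    simp only [hA, hB]; ring
  have d1 : ∀ z, HasDerivAt (fun z => ∫ y, g (z - y) * f y)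
      ((- rexp (-z) * A z + rexp z * B z) / 2) z := by
    intro z
    rw [e]
    have h1 : HasDerivAt (fun z : ℝ => rexp (-z)) (- rexp (-z)) z := by
      simpa using (hasDerivAt_neg z).exp
    have := ((h1.mul (dA z)).add ((Real.hasDerivAt_exp z).mul (dB z))).div_const 2
    refine this.congr_deriv ?_
    have hz : rexp (-z) * rexp z = 1 := by rw [← Real.exp_add]; simp
    linear_combination (0:ℝ) * hz
  have dd : deriv (fun z => ∫ y, g (z - y) * f y)
      = fun z => (- rexp (-z) * A z + rexp z * B z) / 2 := funext fun z => (d1 z).deriv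
  refine ⟨by rw [dd]; exact d1 x, ?_⟩
  rw [dd, show (∫ y, g (x - y) * f y) = (rexp (-x) * A x + rexp x * B x) / 2 from congrFun e x]
  have h1 : HasDerivAt (fun z : ℝ => -rexp (-z)) (rexp (-x)) x := by
    exact (hasDerivAt_neg x).exp.neg.congr_deriv (by simp)
  have := ((h1.mul (dA x)).add ((Real.hasDerivAt_exp x).mul (dB x))).div_const 2
  refine this.congr_deriv ?_
  have hz : rexp (-x) * rexp x = 1 := by rw [← Real.exp_add]; simp
  linear_combination (-f x) * hz

/-- Joint continuity. -/
lemma aux_joint (v : ℝ → ℝ → ℝ) (t : ℝ) (hx : ∀ s ∈ Set.Icc 0 t, Continuous (v s))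
    (ht : ∀ x, ∀ s ∈ Set.Icc 0 t, DifferentiableAt ℝ (fun s => v s x) s)
    (hc : ContinuousOn (fun p : ℝ × ℝ => deriv (fun s => v s p.2) p.1)
      (Set.Icc 0 t ×ˢ Set.univ)) (R : ℝ) :
    ContinuousOn (fun p : ℝ × ℝ => v p.1 p.2) (Set.Icc 0 t ×ˢ Set.Icc (-R) R) := by
  have hcomp : IsCompact (Set.Icc 0 t ×ˢ Set.Icc (-R) R) := isCompact_Icc.prod isCompact_Icc
  obtain ⟨K, hK⟩ := hcomp.exists_bound_of_continuousOn
    (hc.mono (Set.prod_mono le_rfl (Set.subset_univ _)))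
  refine continuousOn_prod_of_continuousOn_lipschitzOnWith _ K.toNNReal
    (fun s hs => (hx s hs).continuousOn) (fun x hxR => ?_)
  refine Convex.lipschitzOnWith_of_nnnorm_deriv_le (fun s hs => ht x s hs) (fun s hs => ?_)
    (convex_Icc 0 t)
  have := hK (s, x) ⟨hs, hxR⟩
  rw [← NNReal.coe_le_coe, coe_nnnorm]
  exact this.trans (Real.le_coe_toNNReal K)

/-- Mixed partials. -/
lemma aux_mixed (v w : ℝ → ℝ → ℝ) (t : ℝ)
    (hv : ∀ s ∈ Set.Icc 0 t, ∀ x, HasDerivAt (v s) (w s x) x)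
    (hw : ∀ s ∈ Set.Icc 0 t, Continuous (w s))
    (hvt : ∀ x, ∀ s ∈ Set.Icc 0 t, DifferentiableAt ℝ (fun s => v s x) s)
    (hwt : ∀ x, ∀ s ∈ Set.Icc 0 t, DifferentiableAt ℝ (fun s => w s x) s)
    (hc : ContinuousOn (fun p : ℝ × ℝ => deriv (fun s => w s p.2) p.1)
      (Set.Icc 0 t ×ˢ Set.univ)) (s : ℝ) (hs : s ∈ Set.Ioo 0 t) (x : ℝ) :
    HasDerivAt (fun z => deriv (fun r => v r z) s) (deriv (fun r => w r x) s) x := by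
  have hsc : s ∈ Set.Icc 0 t := Set.Ioo_subset_Icc_self hs
  have hcs : Continuous (fun y => deriv (fun r => w r y) s) := by
    have : Continuous ((fun p : ℝ × ℝ => deriv (fun s => w s p.2) p.1) ∘ fun y : ℝ => (s, y)) :=
      hc.comp_continuous (by fun_prop) (fun y => ⟨hsc, trivial⟩)
    exact this
  have key : ∀ b, deriv (fun r => v r b) s
      = deriv (fun r => v r 0) s + ∫ y in (0:ℝ)..b, deriv (fun r => w r y) s := by
    intro b
    have hcomp : IsCompact (Set.Icc 0 t ×ˢ Set.uIcc 0 b) := isCompact_Icc.prod isCompact_uIcc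
    obtain ⟨K, hK⟩ := hcomp.exists_bound_of_continuousOn
      (hc.mono (Set.prod_mono le_rfl (Set.subset_univ _)))
    have hn : Set.Ioo 0 t ∈ 𝓝 s := isOpen_Ioo.mem_nhds hs
    have h1 := (intervalIntegral.hasDerivAt_integral_of_dominated_loc_of_deriv_le (μ := volume)
      (F := fun r y => w r y) (F' := fun r y => deriv (fun r => w r y) r)
      (x₀ := s) (s := Set.Ioo 0 t) (a := 0) (b := b) (bound := fun _ => K)
      hn
      (by filter_upwards [hn] with r hr
          exact (hw r (Set.Ioo_subset_Icc_self hr)).aestronglyMeasurable)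
      ((hw s hsc).intervalIntegrable _ _)
      hcs.aestronglyMeasurable
      (ae_of_all _ fun y hy r hr =>
        hK (r, y) ⟨Set.Ioo_subset_Icc_self hr, Set.uIoc_subset_uIcc hy⟩)
      (by simp)
      (ae_of_all _ fun y hy r hr => (hwt y r (Set.Ioo_subset_Icc_self hr)).hasDerivAt)).2
    have h2 : HasDerivAt (fun r => v r b - v r 0)
        (deriv (fun r => v r b) s - deriv (fun r => v r 0) s) s :=
      (hvt b s hsc).hasDerivAt.sub (hvt 0 s hsc).hasDerivAt
    have h3 : (fun r => v r b - v r 0) =ᶠ[𝓝 s] fun r => ∫ y in (0:ℝ)..b, w r y := by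
      filter_upwards [hn] with r hr
      have hr := Set.Ioo_subset_Icc_self hr
      exact (intervalIntegral.integral_eq_sub_of_hasDerivAt (fun y _ => hv r hr y)
        ((hw r hr).intervalIntegrable _ _)).symm
    have := h2.unique (h1.congr_of_eventuallyEq h3)
    linarith
  have : (fun z => deriv (fun r => v r z) s) = fun b => 
      deriv (fun r => v r 0) s + ∫ y in (0:ℝ)..b, deriv (fun r => w r y) s := funext key
  rw [this]
  exact (hcs.integral_hasStrictDerivAt 0 x).hasDerivAt.const_add _

/-- The nonlocal potential `g ∗ f_t`. -/
noncomputable def auxP (n : ℕ) (u : ℝ → ℝ → ℝ) (t x : ℝ) : ℝ :=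
  ∫ y : ℝ, g (x - y) * fLoc n u t y

/-- The energy flux. -/
noncomputable def auxJ (n : ℕ) (u : ℝ → ℝ → ℝ) (t x : ℝ) : ℝ :=
  -(u t x * auxP n u t x) - u t x ^ n * ux u t x ^ 2 / 2
    + ((n : ℝ) * ((n : ℝ) + 3) / (2 * ((n : ℝ) + 1)) - 1) / ((n : ℝ) + 2) * u t x ^ (n + 2)

lemma aux_fLoc_bound (n : ℕ) (u : ℝ → ℝ → ℝ) (t x M : ℝ) (h : |u t x| + |ux u t x| ≤ M) :
    |fLoc n u t x| ≤ ((n : ℝ) / 2) * M ^ (n - 1) * M ^ 2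
      + ((n : ℝ) * ((n : ℝ) + 3) / (2 * ((n : ℝ) + 1))) * M ^ (n + 1) := by
  have h1 : |u t x| ≤ M := by linarith [abs_nonneg (ux u t x)]
  have h2 : |ux u t x| ≤ M := by linarith [abs_nonneg (u t x)]
  have hM : 0 ≤ M := (abs_nonneg _).trans h1
  unfold fLoc
  refine (abs_add_le _ _).trans ?_
  rw [abs_mul, abs_mul, abs_mul, abs_pow, abs_pow, abs_pow,
    abs_of_nonneg (show (0:ℝ) ≤ (n : ℝ) / 2 by positivity),
    abs_of_nonneg (show (0:ℝ) ≤ (n : ℝ) * ((n : ℝ) + 3) / (2 * ((n : ℝ) + 1)) by positivity)]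
  gcongr

lemma aux_J_bound (n : ℕ) (u : ℝ → ℝ → ℝ) (t x M K : ℝ) (h : |u t x| + |ux u t x| ≤ M)
    (hK : |auxP n u t x| ≤ K) :
    |auxJ n u t x| ≤ M * K + M ^ n * M ^ 2 / 2
      + |((n : ℝ) * ((n : ℝ) + 3) / (2 * ((n : ℝ) + 1)) - 1) / ((n : ℝ) + 2)| * M ^ (n + 2) := by
  have h1 : |u t x| ≤ M := by linarith [abs_nonneg (ux u t x)]
  have h2 : |ux u t x| ≤ M := by linarith [abs_nonneg (u t x)]
  have hM : 0 ≤ M := (abs_nonneg _).trans h1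
  unfold auxJ
  refine (abs_add_le _ _).trans ?_
  refine add_le_add ((abs_sub _ _).trans (add_le_add ?_ ?_)) ?_
  · rw [abs_neg, abs_mul]; gcongr
  · rw [abs_div, abs_mul, abs_pow, abs_pow, abs_two]; gcongr
  · rw [abs_mul, abs_pow]; gcongr

lemma aux_J_tendsto (n : ℕ) (hn : 0 < n) (u : ℝ → ℝ → ℝ) (t K : ℝ)
    (h : Tendsto (u t) (cocompact ℝ) (𝓝 0)) (h' : Tendsto (ux u t) (cocompact ℝ) (𝓝 0))
    (hK : ∀ x, |auxP n u t x| ≤ K) :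
    Tendsto (auxJ n u t) (cocompact ℝ) (𝓝 0) := by
  have a1 : Tendsto (fun x => u t x * auxP n u t x) (cocompact ℝ) (𝓝 0) := by
    refine h.zero_mul_isBoundedUnder_le ?_
    exact isBoundedUnder_of ⟨K, fun x => by simpa using hK x⟩
  have a2 := (((h.pow n).mul (h'.pow 2)).div_const 2)
  have a3 := (h.pow (n + 2)).const_mul
    (((n : ℝ) * ((n : ℝ) + 3) / (2 * ((n : ℝ) + 1)) - 1) / ((n : ℝ) + 2))
  have := (a1.neg.sub a2).add a3
  have e : auxJ n u t = fun x => -(u t x * auxP n u t x) - u t x ^ n * ux u t x ^ 2 / 2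
    + ((n : ℝ) * ((n : ℝ) + 3) / (2 * ((n : ℝ) + 1)) - 1) / ((n : ℝ) + 2) * u t x ^ (n + 2) := rfl
  rw [e]
  simpa using this

lemma aux_flux (n : ℕ) (hn : 0 < n) (u : ℝ → ℝ → ℝ) (s x : ℝ)
    (h3 : ContDiff ℝ 3 (u s)) (M : ℝ) (hM : ∀ x, |u s x| + |ux u s x| ≤ M)
    (hnl : ∀ x, ut u s x + u s x ^ n * ux u s x + FLoc n u s x = 0)
    (hmix : HasDerivAt (ut u s) (utx u s x) x) :
    HasDerivAt (auxJ n u s) (u s x * ut u s x + ux u s x * utx u s x) x := by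
  have h1 : HasDerivAt (u s) (ux u s x) x :=
    ((h3.differentiable (by norm_num)) x).hasDerivAt
  have h3' : ContDiff ℝ 2 (deriv (u s)) := by
    have : ContDiff ℝ (2 + 1) (u s) := by
      convert h3 using 1; norm_num
    exact (contDiff_succ_iff_deriv.1 this).2.2
  have h2 : HasDerivAt (ux u s) (uxx u s x) x :=
    ((h3'.differentiable (by norm_num)) x).hasDerivAt
  have cu : Continuous (u s) := h3.continuous
  have cux : Continuous (ux u s) := h3'.continuous
  have cf : Continuous (fLoc n u s) := by unfold fLoc; fun_prop
  obtain ⟨p1, p2⟩ := aux_conv (fLoc n u s) cf _ (fun y => aux_fLoc_bound n u s y M (hM y)) x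
  have p1 : HasDerivAt (auxP n u s) (FLoc n u s x) x := p1
  have p2 : HasDerivAt (FLoc n u s) (auxP n u s x - fLoc n u s x) x := p2
  have hut : ut u s = fun x => -(u s x ^ n * ux u s x) - FLoc n u s x := by
    funext z; linarith [hnl z]
  have hutx := hmix
  rw [hut] at hutx
  have hutx := hutx.unique (((h1.pow n).mul h2).neg.sub p2)
  have hJ := ((h1.mul p1).neg.sub (((h1.pow n).mul (h2.pow 2)).div_const 2)).add
    ((h1.pow (n + 2)).const_mul
      (((n : ℝ) * ((n : ℝ) + 3) / (2 * ((n : ℝ) + 1)) - 1) / ((n : ℝ) + 2)))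
  refine HasDerivAt.congr_deriv hJ ?_
  rw [hutx, hut]
  obtain ⟨m, rfl⟩ : ∃ m, n = m + 1 := ⟨n - 1, by omega⟩
  simp only [fLoc, Nat.add_sub_cancel, Pi.pow_apply]
  push_cast
  have e1 : (m : ℝ) + 1 + 1 ≠ 0 := by positivity
  have e2 : (m : ℝ) + 1 + 2 ≠ 0 := by positivity
  field_simp
  ring

lemma aux_mem {T : ℝ≥0∞} {t s : ℝ} (ht : t ∈ timeDomain T) (hs : s ∈ Set.Icc 0 t) :
    s ∈ timeDomain T :=
  ⟨hs.1, (ENNReal.ofReal_le_ofReal hs.2).trans_lt ht.2⟩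

/-- The energy `H(t) = (1/2)∫ (u² + u_x²) dx` is conserved. -/
theorem conservation_of_energy
    (n : ℕ) (hn : 0 < n) (T : ℝ≥0∞) (hT : 0 < T) (u : ℝ → ℝ → ℝ)
    (hu : IsClassicalSolution n T u) :
    ∀ t ∈ timeDomain T,
      (∫ x : ℝ, (u t x ^ 2 + ux u t x ^ 2)) = ∫ x : ℝ, (u 0 x ^ 2 + ux u 0 x ^ 2) := by
  intro t ht
  have t0 : 0 ≤ t := ht.1
  have hmem : ∀ s ∈ Set.Icc 0 t, s ∈ timeDomain T := fun s hs => aux_mem ht hs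
  obtain ⟨M, hM⟩ := hu.sup_bound t ht
  have c1 : ∀ s ∈ Set.Icc 0 t, ContDiff ℝ 2 (deriv (u s)) := fun s hs => by
    have : ContDiff ℝ (2 + 1) (u s) := by convert hu.contDiff_x s (hmem s hs) using 1; norm_num
    exact (contDiff_succ_iff_deriv.1 this).2.2
  have cu : ∀ s ∈ Set.Icc 0 t, Continuous (u s) := fun s hs =>
    (hu.contDiff_x s (hmem s hs)).continuous
  have cux : ∀ s ∈ Set.Icc 0 t, Continuous (ux u s) := fun s hs => (c1 s hs).continuous
  have cut : ContinuousOn (fun p : ℝ × ℝ => ut u p.1 p.2) (Set.Icc 0 t ×ˢ Set.univ) :=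
    hu.cont_ut.mono (Set.prod_mono hmem le_rfl)
  have cutx : ContinuousOn (fun p : ℝ × ℝ => utx u p.1 p.2) (Set.Icc 0 t ×ˢ Set.univ) :=
    hu.cont_utx.mono (Set.prod_mono hmem le_rfl)
  have ju := aux_joint u t cu (fun x s hs => hu.diff_t x s (hmem s hs)) cut
  have jux := aux_joint (ux u) t cux (fun x s hs => hu.diff_tx x s (hmem s hs)) cutx
  have hmix : ∀ s ∈ Set.Ioo 0 t, ∀ x, HasDerivAt (ut u s) (utx u s x) x := fun s hs x =>
    aux_mixed u (ux u) t
      (fun r hr y => ((hu.contDiff_x r (hmem r hr)).differentiable (by norm_num) y).hasDerivAt)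
      cux (fun x s hs => hu.diff_t x s (hmem s hs)) (fun x s hs => hu.diff_tx x s (hmem s hs))
      cutx s hs x
  -- the time derivative of the energy density
  set h : ℝ → ℝ → ℝ := fun s x => 2 * (u s x * ut u s x + ux u s x * utx u s x) with hh
  have jh : ∀ R, ContinuousOn (fun p : ℝ × ℝ => h p.1 p.2)
      (Set.Icc 0 t ×ˢ Set.Icc (-R) R) := fun R => by
    have a := cut.mono (Set.prod_mono (le_refl (Set.Icc 0 t)) (Set.subset_univ (Set.Icc (-R) R)))
    have b := cutx.mono (Set.prod_mono (le_refl (Set.Icc 0 t)) (Set.subset_univ (Set.Icc (-R) R)))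
    exact continuousOn_const.mul (((ju R).mul a).add ((jux R).mul b))
  have ftc : ∀ x, (u t x ^ 2 + ux u t x ^ 2) - (u 0 x ^ 2 + ux u 0 x ^ 2)
      = ∫ s in (0:ℝ)..t, h s x := by
    intro x
    symm
    refine intervalIntegral.integral_eq_sub_of_hasDerivAt
      (f := fun s => u s x ^ 2 + ux u s x ^ 2) (fun s hs => ?_) ?_
    · rw [Set.uIcc_of_le t0] at hs
      have d1 : HasDerivAt (fun s => u s x) (ut u s x) s :=
        (hu.diff_t x s (hmem s hs)).hasDerivAt
      have d2 : HasDerivAt (fun s => ux u s x) (utx u s x) s :=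
        (hu.diff_tx x s (hmem s hs)).hasDerivAt
      refine ((d1.pow 2).add (d2.pow 2)).congr_deriv ?_
      simp only [hh]; push_cast; ring
    · apply ContinuousOn.intervalIntegrable
      rw [Set.uIcc_of_le t0]
      exact (jh |x|).comp (f := fun s : ℝ => (s, x)) (by fun_prop)
        (fun s hs => ⟨hs, abs_le.1 le_rfl⟩)
  -- bounds
  obtain ⟨Kp, hKp⟩ : ∃ Kp, ∀ s ∈ Set.Icc 0 t, ∀ x, |auxP n u s x| ≤ Kp :=
    ⟨_, fun s hs x => aux_conv_bound _ _ (fun y => aux_fLoc_bound n u s y M (hM s hs y)) x⟩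
  obtain ⟨KJ, hKJ⟩ : ∃ KJ, ∀ s ∈ Set.Icc 0 t, ∀ x, |auxJ n u s x| ≤ KJ :=
    ⟨_, fun s hs x => aux_J_bound n u s x M Kp (hM s hs x) (hKp s hs x)⟩
  have slice : ∀ s ∈ Set.Ioo 0 t, ∀ R, 0 ≤ R →
      ∫ x in (-R)..R, h s x = 2 * (auxJ n u s R - auxJ n u s (-R)) := by
    intro s hs R hR
    have hsc := Set.Ioo_subset_Icc_self hs
    rw [intervalIntegral.integral_eq_sub_of_hasDerivAt (f := fun x => 2 * auxJ n u s x)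
      (fun x _ => (aux_flux n hn u s x (hu.contDiff_x s (hmem s hsc)) M (hM s hsc)
        (hu.nonlocal s (hmem s hsc)) (hmix s hs x)).const_mul 2) ?_]
    · ring
    · apply ContinuousOn.intervalIntegrable
      rw [Set.uIcc_of_le (by linarith)]
      exact (jh R).comp (f := fun x : ℝ => (s, x)) (by fun_prop) (fun x hx => ⟨hsc, hx⟩)
  have hae : ∀ᵐ s : ℝ, s ≠ t := by simp [ae_iff]
  have swap : ∀ R, 0 ≤ R → ∫ x in (-R)..R, ((u t x ^ 2 + ux u t x ^ 2)
      - (u 0 x ^ 2 + ux u 0 x ^ 2)) = ∫ s in (0:ℝ)..t, ∫ x in (-R)..R, h s x := by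
    intro R hR
    simp only [ftc]
    symm
    apply intervalIntegral_intervalIntegral_swap
    refine IntegrableOn.mono_set ((jh R).integrableOn_compact (isCompact_Icc.prod isCompact_Icc)) ?_
    rw [Set.uIoc_of_le t0, Set.uIoc_of_le (by linarith)]
    exact Set.prod_mono Set.Ioc_subset_Icc_self Set.Ioc_subset_Icc_self
  have int_e : ∀ s ∈ Set.Icc 0 t, Integrable (fun x => u s x ^ 2 + ux u s x ^ 2) := fun s hs =>
    (hu.decay_u s (hmem s hs)).2.2.1.add (hu.decay_ux s (hmem s hs)).2.2.1
  have i1 := int_e t ⟨t0, le_rfl⟩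
  have i0 := int_e 0 ⟨le_rfl, t0⟩
  have lim1 := intervalIntegral_tendsto_integral (i1.sub i0) tendsto_neg_atTop_atBot
    (tendsto_id (α := ℝ) (x := atTop))
  have lim2 : Tendsto (fun R => ∫ s in (0:ℝ)..t, ∫ x in (-R)..R, h s x) atTop
      (𝓝 (∫ s in (0:ℝ)..t, (0:ℝ))) := by
    refine intervalIntegral.tendsto_integral_filter_of_dominated_convergence
      (fun _ => 2 * (KJ + KJ)) ?_ ?_ (by simp) ?_
    · filter_upwards [eventually_ge_atTop 0] with R hR
      have hint : IntegrableOn (fun p : ℝ × ℝ => h p.1 p.2)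
          (Set.Ioc 0 t ×ˢ Set.Ioc (-R) R) (volume.prod volume) :=
        IntegrableOn.mono_set ((jh R).integrableOn_compact (isCompact_Icc.prod isCompact_Icc))
          (Set.prod_mono Set.Ioc_subset_Icc_self Set.Ioc_subset_Icc_self)
      rw [IntegrableOn, ← Measure.prod_restrict] at hint
      rw [Set.uIoc_of_le t0]
      simp only [intervalIntegral.integral_of_le (show -R ≤ R by linarith)]
      exact hint.integral_prod_left.aestronglyMeasurable
    · filter_upwards [eventually_ge_atTop 0] with R hR
      filter_upwards [hae] with s hst hs
      rw [Set.uIoc_of_le t0] at hs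
      have hs : s ∈ Set.Ioo 0 t := ⟨hs.1, lt_of_le_of_ne hs.2 hst⟩
      have hsc := Set.Ioo_subset_Icc_self hs
      rw [slice s hs R hR, norm_mul, Real.norm_eq_abs, Real.norm_eq_abs, abs_two]
      have := (abs_sub (auxJ n u s R) (auxJ n u s (-R))).trans
        (add_le_add (hKJ s hsc R) (hKJ s hsc (-R)))
      linarith
    · filter_upwards [hae] with s hst hs
      rw [Set.uIoc_of_le t0] at hs
      have hs : s ∈ Set.Ioo 0 t := ⟨hs.1, lt_of_le_of_ne hs.2 hst⟩
      have hsc := Set.Ioo_subset_Icc_self hs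
      have hJ := aux_J_tendsto n hn u s Kp (hu.decay_u s (hmem s hsc)).2.2.2
        (hu.decay_ux s (hmem s hsc)).2.2.2 (hKp s hsc)
      have a := hJ.mono_left atTop_le_cocompact
      have b := (hJ.mono_left atBot_le_cocompact).comp tendsto_neg_atTop_atBot
      have := (a.sub b).const_mul 2
      simp only [sub_zero, mul_zero] at this
      refine this.congr' ?_
      filter_upwards [eventually_ge_atTop 0] with R hR
      exact (slice s hs R hR).symm
  have lim3 := lim2.congr' (by
    filter_upwards [eventually_ge_atTop 0] with R hR
    exact (swap R hR).symm)
  have := tendsto_nhds_unique lim1 lim3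
  simp only [Pi.sub_apply, intervalIntegral.integral_zero] at this
  rw [integral_sub i1 i0] at this
  linarith
end
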